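/- Assume q > 2 is fixed. As g → ∞, each of the following ratios tends to 1: (1/#I_{g+1})·Σ_{u ∈ I_{g+1}} L(1,χ_u) divided by ζ_A(2)·P(2); (1/#F_{g+1})·Σ_{u ∈ F_{g+1}} L(1,χ_u) divided by ζ_A(2)·P(2); and (1/#F'_{g+1})·Σ_{u ∈ F'_{g+1}} L(1,χ_u) divided by ζ_A(2)·P(2). -/

import Mathlib

open Polynomial UniqueFactorizationMonoid

noncomputable section

namespace EvenChar

variable {Fq : Type} [Field Fq] [Fintype Fq]

/-- Solvability of the congruence `X² + X ≡ u (mod P)` in `Fq[T]`. -/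
def hasseSolvable (u : RatFunc Fq) (P : Polynomial Fq) : Prop :=
  ∃ x : Polynomial Fq, P ∣ ((x ^ 2 + x) * u.denom - u.num)

open scoped Classical in
/-- The quadratic symbol `{u/f}` for a monic polynomial `f`. -/
def quadSym (u : RatFunc Fq) (f : Polynomial Fq) : ℤ :=
  if IsCoprime f u.denom then
    ((normalizedFactors f).map fun P => if hasseSolvable u P then (1 : ℤ) else -1).prod
  else 0

variable (Fq) in
/-- The family `F_n` of real quadratic `u`'s. -/
def Ffam (n : ℕ) : Set (RatFunc Fq) :=
  { u | ∃ (S : Finset (Polynomial Fq)) (e : Polynomial Fq → ℕ)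
        (a : Polynomial Fq → ℕ → Polynomial Fq),
      (∀ P ∈ S, P.Monic ∧ Irreducible P) ∧
      (∀ P ∈ S, 1 ≤ e P) ∧
      (∀ P ∈ S, ∀ i, 1 ≤ i → i ≤ e P → (a P i).degree < P.degree) ∧
      (∀ P ∈ S, a P (e P) ≠ 0) ∧
      (∑ P ∈ S, e P * P.natDegree) = n ∧
      u = ∑ P ∈ S, ∑ i ∈ Finset.Icc 1 (e P),
            algebraMap (Polynomial Fq) (RatFunc Fq) (a P i) /
              algebraMap (Polynomial Fq) (RatFunc Fq) P ^ (2 * i - 1) }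

/-- The family `G_s` of odd polynomial parts. -/
def Gfam (ξ : Fq) (s : ℕ) : Set (Polynomial Fq) :=
  { G | ∃ (α : Fq) (c : ℕ → Fq), (α = 0 ∨ α = ξ) ∧ c s ≠ 0 ∧
      G = C α + ∑ i ∈ Finset.Icc 1 s, C (c i) * X ^ (2 * i - 1) }

/-- The family `I_{(r,s)}`. -/
def Irs (ξ : Fq) (r s : ℕ) : Set (RatFunc Fq) :=
  { u | ∃ v ∈ Ffam Fq r, ∃ G ∈ Gfam ξ s,
      u = v + algebraMap (Polynomial Fq) (RatFunc Fq) G }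

/-- The family `I_n` of ramified imaginary `u`'s. -/
def Ifam (ξ : Fq) (n : ℕ) : Set (RatFunc Fq) :=
  ⋃ (r : ℕ) (s : ℕ) (_ : 1 ≤ s) (_ : r + s = n), Irs ξ r s

/-- The family `F'_n` of inert imaginary `u`'s. -/
def F'fam (ξ : Fq) (n : ℕ) : Set (RatFunc Fq) :=
  (fun u => u + RatFunc.C ξ) '' Ffam Fq n

/-- `A_u(n) = ∑_{f monic, deg f = n} χ_u(f)`. -/
def Acoeff (u : RatFunc Fq) (n : ℕ) : ℂ :=
  ∑' f : {f : Polynomial Fq // f.Monic ∧ f.natDegree = n}, (quadSym u f.1 : ℂ)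

/-- `L(s, χ_u)` as the polynomial `∑_{n=0}^{N} A_u(n) q^{-sn}` in `q^{-s}`. -/
def Lfun (N : ℕ) (u : RatFunc Fq) (s : ℂ) : ℂ :=
  ∑ n ∈ Finset.range (N + 1), Acoeff u n * (Fintype.card Fq : ℂ) ^ (-(s * (n : ℂ)))

/-- `ζ_A(s) = (1 - q^{1-s})⁻¹`. -/
def zetaC (q : ℕ) (s : ℂ) : ℂ := (1 - (q : ℂ) ^ ((1 : ℂ) - s))⁻¹

variable (Fq) in
/-- The Euler product `P(s) = ∏_P (1 - 1/(|P|^s (|P|+1)))`. -/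
def eulerP (s : ℂ) : ℂ :=
  ∏' P : {P : Polynomial Fq // P.Monic ∧ Irreducible P},
    (1 - (((Fintype.card Fq : ℂ) ^ (P.1.natDegree : ℂ)) ^ s *
          ((Fintype.card Fq : ℂ) ^ (P.1.natDegree : ℂ) + 1))⁻¹)

variable (Fq) in
/-- `(1/log q)·(P'/P)(1) = ∑_P deg P / (|P|(|P|+1) - 1)`. -/
def eulerPlogDeriv : ℂ :=
  ∑' P : {P : Polynomial Fq // P.Monic ∧ Irreducible P},
    (P.1.natDegree : ℂ) /
      ((Fintype.card Fq : ℂ) ^ (P.1.natDegree : ℂ) *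
        ((Fintype.card Fq : ℂ) ^ (P.1.natDegree : ℂ) + 1) - 1)

end EvenChar

namespace EvenChar
section symbol
set_option linter.unusedSectionVars false
variable {Fq : Type} [Field Fq] [Fintype Fq]

/-- An absolute-trace-like sum over a field of characteristic two. -/
def tau {K : Type} [Field K] (k : ℕ) (y : K) : K := ∑ i ∈ Finset.range k, y ^ (2 ^ i)

lemma tau_add {K : Type} [Field K] [CharP K 2] (k : ℕ) (x y : K) :
    tau k (x + y) = tau k x + tau k y := by
  simp only [tau, ← Finset.sum_add_distrib, add_pow_char_pow]

lemma tau_zero {K : Type} [Field K] (k : ℕ) : tau k (0 : K) = 0 := by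
  simp [tau]

lemma tau_map {K L : Type} [Field K] [Field L] (φ : K →+* L) (k : ℕ) (y : K) :
    φ (tau k y) = tau k (φ y) := by
  simp [tau]

lemma tau_sq {K : Type} [Field K] [CharP K 2] (k : ℕ) (y : K) :
    (tau k y) ^ 2 = tau k (y ^ 2) := by
  simp only [tau, sum_pow_char]
  refine Finset.sum_congr rfl fun i _ => by rw [← pow_mul, ← pow_mul, mul_comm]

lemma tau_wp {K : Type} [Field K] [CharP K 2] (k : ℕ) (y : K) :
    tau k (y ^ 2 + y) = y ^ 2 ^ k + y := by
  induction k with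
  | zero => simp [tau, CharTwo.add_self_eq_zero]
  | succ k ih =>
    have : tau (k+1) (y^2+y) = tau k (y^2+y) + (y^2+y)^(2^k) := by
      simp [tau, Finset.sum_range_succ]
    rw [this, ih, add_pow_char_pow, ← pow_mul, ← pow_succ']
    have h2 : y ^ 2 ^ k + y ^ 2 ^ k = 0 := CharTwo.add_self_eq_zero _
    linear_combination h2

lemma tau_mul_eq {K : Type} [Field K] [CharP K 2] (k D : ℕ) (y : K) :
    tau (k * D) y = tau k (∑ l ∈ Finset.range D, y ^ ((2 ^ k) ^ l)) := by
  induction D with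
  | zero => simp [tau]
  | succ D ih =>
    rw [Finset.sum_range_succ, tau_add, ← ih]
    simp only [tau, mul_add, mul_one, Finset.sum_range_add]
    congr 1
    refine Finset.sum_congr rfl fun i _ => ?_
    rw [← pow_mul, ← pow_mul, ← pow_add]

/-- In a finite field of size `2^N`, `x²+x=y` is solvable iff the trace vanishes. -/
lemma wp_solvable_iff {L : Type} [Field L] [Fintype L] [CharP L 2] (N : ℕ)
    (hN : Fintype.card L = 2 ^ N) (y : L) :
    (∃ z : L, z ^ 2 + z = y) ↔ tau N y = 0 := by
  constructor
  · rintro ⟨z, rfl⟩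
    rw [tau_wp, ← hN, FiniteField.pow_card, CharTwo.add_self_eq_zero]
  · intro h
    let K := AlgebraicClosure L
    have : CharP K 2 := charP_of_injective_algebraMap (algebraMap L K).injective 2
    obtain ⟨x, hx⟩ : ∃ x : K, x ^ 2 + x = algebraMap L K y := by
      have hd : (X ^ 2 + X + C (algebraMap L K y) : K[X]).degree = 2 := by compute_degree!
      obtain ⟨x, hx⟩ := IsAlgClosed.exists_root (X ^ 2 + X + C (algebraMap L K y) : K[X])
        (by rw [hd]; norm_num)
      refine ⟨x, ?_⟩
      simp only [IsRoot, eval_add, eval_pow, eval_X, eval_C] at hx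
      exact CharTwo.add_eq_zero.mp hx
    have h1 : x ^ 2 ^ N + x = 0 := by
      rw [← tau_wp, hx, ← tau_map, h, map_zero]
    have h2 : x ^ (Fintype.card L) - x = 0 := by
      rw [hN, CharTwo.sub_eq_add, h1]
    classical
    have hne : (X ^ (Fintype.card L) - X : K[X]) ≠ 0 :=
      FiniteField.X_pow_card_sub_X_ne_zero K Fintype.one_lt_card
    have hsub : Finset.univ.image (algebraMap L K) ⊆ (X ^ (Fintype.card L) - X : K[X]).roots.toFinset := by
      intro b hb
      obtain ⟨a, -, rfl⟩ := Finset.mem_image.mp hb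
      rw [Multiset.mem_toFinset, mem_roots hne]
      simp only [IsRoot, eval_sub, eval_pow, eval_X]
      rw [← map_pow, FiniteField.pow_card, sub_self]
    have hcard : (X ^ (Fintype.card L) - X : K[X]).roots.toFinset.card ≤
        (Finset.univ.image (algebraMap L K)).card := by
      rw [Finset.card_image_of_injective _ (algebraMap L K).injective, Finset.card_univ]
      refine (Multiset.toFinset_card_le _).trans ((card_roots' _).trans ?_)
      rw [FiniteField.X_pow_card_sub_X_natDegree_eq K Fintype.one_lt_card]
    have heq := Finset.eq_of_subset_of_card_le hsub hcard
    have hxm : x ∈ Finset.univ.image (algebraMap L K) := by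
      rw [heq, Multiset.mem_toFinset, mem_roots hne]
      simpa [IsRoot] using h2
    obtain ⟨a, -, rfl⟩ := Finset.mem_image.mp hxm
    refine ⟨a, (algebraMap L K).injective ?_⟩
    rw [← hx]; simp

/-- Evaluation of a rational function at a point of the algebraic closure. -/
def ev (θ : AlgebraicClosure Fq) (u : RatFunc Fq) : AlgebraicClosure Fq :=
  RatFunc.eval (algebraMap Fq (AlgebraicClosure Fq)) θ u

/-- The sum of the values of `u` over the roots of `f`. -/
def lam (f : Fq[X]) (u : RatFunc Fq) : AlgebraicClosure Fq :=
  ((f.aroots (AlgebraicClosure Fq)).map (fun θ => ev θ u)).sum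

lemma lam_mul {f g : Fq[X]} (h : f * g ≠ 0) (u : RatFunc Fq) :
    lam (f * g) u = lam f u + lam g u := by
  simp [lam, aroots_mul h]

lemma lam_one (u : RatFunc Fq) : lam (1 : Fq[X]) u = 0 := by
  simp [lam]

lemma denom_ne_of_coprime {f : Fq[X]} {u : RatFunc Fq} (h : IsCoprime f u.denom)
    {θ : AlgebraicClosure Fq} (hθ : aeval θ f = 0) :
    u.denom.eval₂ (algebraMap Fq (AlgebraicClosure Fq)) θ ≠ 0 := by
  intro h0
  obtain ⟨a, b, hab⟩ := h
  have := congrArg (aeval θ) hab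
  rw [map_add, map_mul, map_mul, hθ, aeval_def θ u.denom, h0] at this
  simp at this

lemma lam_prime {P : Fq[X]} (hm : P.Monic) (hP : Irreducible P) {u : RatFunc Fq}
    (hu : IsCoprime P u.denom) [Fact (Irreducible P)] :
    lam P u = algebraMap Fq _ (Algebra.trace Fq (AdjoinRoot P)
      (RatFunc.eval (AdjoinRoot.of P) (AdjoinRoot.root P) u)) := by
  have : FiniteDimensional Fq (AdjoinRoot P) := (AdjoinRoot.powerBasis hP.ne_zero).finite
  classical
  rw [trace_eq_sum_embeddings (AlgebraicClosure Fq)]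
  have hsep : P.Separable := PerfectField.separable_of_irreducible hP
  rw [Fintype.sum_equiv (AdjoinRoot.equiv (AlgebraicClosure Fq) Fq P hP.ne_zero) _
    (fun θ => ev θ.1 u) , Finset.sum_mem_multiset (P.aroots (AlgebraicClosure Fq)) _ (fun θ => ev θ u),
    Finset.sum_eq_multiset_sum, Multiset.toFinset_val, Multiset.dedup_eq_self.mpr]
  · rfl
  · exact nodup_roots (hsep.map)
  · intro x; rfl
  · intro σ
    have h1 : ((AdjoinRoot.equiv (AlgebraicClosure Fq) Fq P hP.ne_zero) σ).1 = σ (AdjoinRoot.root P) := rfl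
    rw [h1, ev, RatFunc.eval, RatFunc.eval, map_div₀]
    have h2 : ∀ g : Fq[X], σ (eval₂ (AdjoinRoot.of P) (AdjoinRoot.root P) g) =
        eval₂ (algebraMap Fq (AlgebraicClosure Fq)) (σ (AdjoinRoot.root P)) g := by
      intro g
      have := aeval_algHom_apply σ (AdjoinRoot.root P) g
      rw [aeval_def, aeval_def] at this
      exact this.symm
    rw [h2, h2]

lemma card_eq_two_pow [CharP Fq 2] : ∃ k, Fintype.card Fq = 2 ^ k := by
  obtain ⟨n, _, h⟩ := FiniteField.card Fq 2
  exact ⟨n, h⟩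

lemma prime_symbol [CharP Fq 2] {k : ℕ} (hk : Fintype.card Fq = 2 ^ k)
    {P : Fq[X]} (hm : P.Monic) (hP : Irreducible P) {u : RatFunc Fq}
    (hu : IsCoprime P u.denom) :
    (hasseSolvable u P ↔ tau k (lam P u) = 0) ∧ (tau k (lam P u) = 0 ∨ tau k (lam P u) = 1) := by
  have hf : Fact (Irreducible P) := ⟨hP⟩
  have : FiniteDimensional Fq (AdjoinRoot P) := (AdjoinRoot.powerBasis hP.ne_zero).finite
  have : Finite (AdjoinRoot P) := Module.finite_of_finite Fq
  have : Fintype (AdjoinRoot P) := Fintype.ofFinite _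
  have : CharP (AdjoinRoot P) 2 := charP_of_injective_algebraMap (algebraMap Fq (AdjoinRoot P)).injective 2
  have : CharP (AlgebraicClosure Fq) 2 :=
    charP_of_injective_algebraMap (algebraMap Fq (AlgebraicClosure Fq)).injective 2
  rw [lam_prime hm hP hu]
  set y := RatFunc.eval (AdjoinRoot.of P) (AdjoinRoot.root P) u with hy
  set t := Algebra.trace Fq (AdjoinRoot P) y with ht
  have hcard : Fintype.card (AdjoinRoot P) = 2 ^ (k * Module.finrank Fq (AdjoinRoot P)) := by
    rw [Module.card_eq_pow_finrank (K := Fq), hk, pow_mul]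
  have hden : AdjoinRoot.mk P u.denom ≠ 0 := by
    rw [Ne, AdjoinRoot.mk_eq_zero]
    intro hd
    exact hP.not_isUnit (hu.isUnit_of_dvd' dvd_rfl hd)
  have hyy : y = AdjoinRoot.mk P u.num / AdjoinRoot.mk P u.denom := by
    rw [hy, RatFunc.eval, ← AdjoinRoot.algebraMap_eq, ← aeval_def, ← aeval_def, AdjoinRoot.aeval_eq,
      AdjoinRoot.aeval_eq]
  have h1 : hasseSolvable u P ↔ ∃ z : AdjoinRoot P, z ^ 2 + z = y := by
    constructor
    · rintro ⟨x, hx⟩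
      refine ⟨AdjoinRoot.mk P x, ?_⟩
      rw [← AdjoinRoot.mk_eq_zero] at hx
      rw [hyy, eq_div_iff hden]
      simpa [sub_eq_zero] using hx
    · rintro ⟨z, hz⟩
      obtain ⟨x, rfl⟩ := AdjoinRoot.mk_surjective z
      refine ⟨x, ?_⟩
      rw [← AdjoinRoot.mk_eq_zero]
      rw [hyy, eq_div_iff hden] at hz
      simpa [sub_eq_zero] using hz
  have h2 : tau (k * Module.finrank Fq (AdjoinRoot P)) y = algebraMap Fq _ (tau k t) := by
    rw [tau_map, ht, FiniteField.algebraMap_trace_eq_sum_pow, tau_mul_eq, Nat.card_eq_fintype_card, hk]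
  have h3 : tau k t = 0 ∨ tau k t = 1 := by
    have : (tau k t) ^ 2 + tau k t = 0 := by
      rw [tau_sq, ← tau_add, tau_wp, ← hk, FiniteField.pow_card, CharTwo.add_self_eq_zero]
    have h4 : tau k t * (tau k t + 1) = 0 := by linear_combination this
    rcases mul_eq_zero.mp h4 with h | h
    · exact Or.inl h
    · exact Or.inr (CharTwo.add_eq_zero.mp h)
  rw [h1, wp_solvable_iff _ hcard, h2, ← tau_map]
  constructor
  · rw [map_eq_zero_iff _ (algebraMap Fq (AdjoinRoot P)).injective,
      map_eq_zero_iff _ (algebraMap Fq (AlgebraicClosure Fq)).injective]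
  · rcases h3 with h | h <;> simp [h]

open scoped Classical in
lemma symbol_eq [CharP Fq 2] {k : ℕ} (hk : Fintype.card Fq = 2 ^ k)
    {f : Fq[X]} (hm : f.Monic) {u : RatFunc Fq} (hu : IsCoprime f u.denom) :
    (quadSym u f = if tau k (lam f u) = 0 then 1 else -1) ∧
      (tau k (lam f u) = 0 ∨ tau k (lam f u) = 1) := by
  have : CharP (AlgebraicClosure Fq) 2 :=
    charP_of_injective_algebraMap (algebraMap Fq (AlgebraicClosure Fq)).injective 2
  rw [quadSym, if_pos hu]
  have hprod : (normalizedFactors f).prod = f := by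
    rw [prod_normalizedFactors_eq hm.ne_zero, hm.normalize_eq_self]
  have key : ∀ s : Multiset Fq[X], (∀ P ∈ s, P.Monic ∧ Irreducible P ∧ IsCoprime P u.denom) →
      ((s.map fun P => if hasseSolvable u P then (1 : ℤ) else -1).prod =
        if tau k (lam s.prod u) = 0 then 1 else -1) ∧
      (tau k (lam s.prod u) = 0 ∨ tau k (lam s.prod u) = 1) := by
    intro s
    induction s using Multiset.induction_on with
    | empty => intro _; simp [lam_one, tau_zero]
    | cons P s ih =>
      intro h
      obtain ⟨ih1, ih2⟩ := ih (fun Q hQ => h Q (Multiset.mem_cons_of_mem hQ))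
      obtain ⟨hPm, hPi, hPc⟩ := h P (Multiset.mem_cons_self _ _)
      obtain ⟨p1, p2⟩ := prime_symbol hk hPm hPi hPc
      have hne : P * s.prod ≠ 0 := by
        refine mul_ne_zero hPi.ne_zero (Multiset.prod_ne_zero ?_)
        intro h0
        exact (h 0 (Multiset.mem_cons_of_mem h0)).2.1.ne_zero rfl
      rw [Multiset.map_cons, Multiset.prod_cons, Multiset.prod_cons, lam_mul hne, tau_add, ih1]
      simp only [p1]
      rcases ih2 with h2 | h2 <;> rcases p2 with h3 | h3 <;> simp [h2, h3, CharTwo.add_self_eq_zero]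
  have := key (normalizedFactors f) (fun P hP => by
    have hirr := irreducible_of_normalized_factor P hP
    refine ⟨?_, hirr, ?_⟩
    · rw [← normalize_normalized_factor P hP]; exact monic_normalize hirr.ne_zero
    · exact hu.of_isCoprime_of_dvd_left (dvd_of_mem_normalizedFactors hP))
  rwa [hprod] at this
end symbol
end EvenChar

namespace EvenChar
section symbol2
set_option linter.unusedSectionVars false
variable {Fq : Type} [Field Fq] [Fintype Fq]

lemma coprime_denom_add {f : Fq[X]} {u v : RatFunc Fq} (hu : IsCoprime f u.denom)
    (hv : IsCoprime f v.denom) : IsCoprime f (u + v).denom :=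
  (hu.mul_right hv).of_isCoprime_of_dvd_right (RatFunc.denom_add_dvd u v)

lemma coprime_denom_mul {f : Fq[X]} {u v : RatFunc Fq} (hu : IsCoprime f u.denom)
    (hv : IsCoprime f v.denom) : IsCoprime f (u * v).denom :=
  (hu.mul_right hv).of_isCoprime_of_dvd_right (RatFunc.denom_mul_dvd u v)

lemma coprime_denom_div {f a b : Fq[X]} (h : IsCoprime f b) :
    IsCoprime f (algebraMap Fq[X] (RatFunc Fq) a / algebraMap Fq[X] (RatFunc Fq) b).denom :=
  h.of_isCoprime_of_dvd_right (RatFunc.denom_div_dvd a b)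

lemma coprime_denom_poly {f a : Fq[X]} :
    IsCoprime f (algebraMap Fq[X] (RatFunc Fq) a).denom := by
  rw [RatFunc.denom_algebraMap]; exact isCoprime_one_right

lemma coprime_denom_neg {f : Fq[X]} {u : RatFunc Fq} (hu : IsCoprime f u.denom) :
    IsCoprime f (-u).denom := by
  have : -u = algebraMap Fq[X] (RatFunc Fq) (-1) * u := by simp
  rw [this]
  exact coprime_denom_mul coprime_denom_poly hu

lemma lam_add {f : Fq[X]} (hf : f ≠ 0) {u v : RatFunc Fq} (hu : IsCoprime f u.denom)
    (hv : IsCoprime f v.denom) : lam f (u + v) = lam f u + lam f v := by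
  rw [lam, lam, lam, ← Multiset.sum_map_add]
  refine congrArg _ (Multiset.map_congr rfl fun θ hθ => ?_)
  have h := (mem_aroots.mp hθ).2
  exact RatFunc.eval_add _ _ (denom_ne_of_coprime hu h) (denom_ne_of_coprime hv h)

lemma quadSym_add [CharP Fq 2] {f : Fq[X]} (hm : f.Monic) {u v : RatFunc Fq}
    (hu : IsCoprime f u.denom) (hv : IsCoprime f v.denom) :
    quadSym (u + v) f = quadSym u f * quadSym v f := by
  have : CharP (AlgebraicClosure Fq) 2 :=
    charP_of_injective_algebraMap (algebraMap Fq (AlgebraicClosure Fq)).injective 2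
  obtain ⟨k, hk⟩ := card_eq_two_pow (Fq := Fq)
  obtain ⟨a1, a2⟩ := symbol_eq hk hm hu
  obtain ⟨b1, b2⟩ := symbol_eq hk hm hv
  obtain ⟨c1, c2⟩ := symbol_eq hk hm (coprime_denom_add hu hv)
  rw [a1, b1, c1, lam_add hm.ne_zero hu hv, tau_add]
  rcases a2 with h2 | h2 <;> rcases b2 with h3 | h3 <;> simp [h2, h3, CharTwo.add_self_eq_zero]

lemma quadSym_pm [CharP Fq 2] {f : Fq[X]} (hm : f.Monic) {u : RatFunc Fq}
    (hu : IsCoprime f u.denom) : quadSym u f = 1 ∨ quadSym u f = -1 := by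
  obtain ⟨k, hk⟩ := card_eq_two_pow (Fq := Fq)
  rw [(symbol_eq hk hm hu).1]
  split_ifs <;> simp

lemma quadSym_not {f : Fq[X]} {u : RatFunc Fq}
    (hu : ¬ IsCoprime f u.denom) : quadSym u f = 0 := by
  rw [quadSym, if_neg hu]

open scoped Classical in
lemma quadSym_wp [CharP Fq 2] {f : Fq[X]} (hm : f.Monic) {x : RatFunc Fq}
    (hx : IsCoprime f x.denom) : quadSym (x ^ 2 + x) f = 1 := by
  rw [quadSym, if_pos (coprime_denom_add (by rw [sq]; exact coprime_denom_mul hx hx) hx)]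
  refine Multiset.prod_eq_one ?_
  intro z hz
  obtain ⟨P, hP, rfl⟩ := Multiset.mem_map.mp hz
  have hirr := irreducible_of_normalized_factor P hP
  have hPm : P.Monic := by
    rw [← normalize_normalized_factor P hP]; exact monic_normalize hirr.ne_zero
  have hc : IsCoprime P x.denom := hx.of_isCoprime_of_dvd_left (dvd_of_mem_normalizedFactors hP)
  have hc2 : IsCoprime P (x ^ 2 + x).denom :=
    coprime_denom_add (by rw [sq]; exact coprime_denom_mul hc hc) hc
  rw [if_pos]
  obtain ⟨a, b, hab⟩ := hc
  -- b * denom ≡ 1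
  refine ⟨b * x.num, ?_⟩
  have hd := RatFunc.num_div_denom x
  have hdn : algebraMap Fq[X] (RatFunc Fq) x.denom ≠ 0 := RatFunc.algebraMap_ne_zero x.denom_ne_zero
  have hdn2 : algebraMap Fq[X] (RatFunc Fq) (x ^ 2 + x).denom ≠ 0 :=
    RatFunc.algebraMap_ne_zero (x ^ 2 + x).denom_ne_zero
  have hd2 := RatFunc.num_div_denom (x ^ 2 + x)
  have e1 : (x.num ^ 2 + x.num * x.denom) * (x ^ 2 + x).denom = (x ^ 2 + x).num * x.denom ^ 2 := by
    apply RatFunc.algebraMap_injective Fq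
    simp only [map_mul, map_add, map_pow]
    rw [div_eq_iff hdn2] at hd2
    rw [hd2]
    rw [div_eq_iff hdn] at hd
    rw [hd]
    ring
  have hcop : IsCoprime P (x.denom ^ 2) := IsCoprime.pow_right ⟨a, b, hab⟩
  refine hcop.dvd_of_dvd_mul_right ?_
  have : ((b * x.num) ^ 2 + b * x.num) * (x ^ 2 + x).denom * x.denom ^ 2 -
      (x ^ 2 + x).num * x.denom ^ 2 =
      (x ^ 2 + x).denom * ((b * x.denom - 1) * ((b * x.denom + 1) * x.num ^ 2 + x.num * x.denom)) := by
    rw [← e1]; ring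
  rw [sub_mul, this]
  have h1 : b * x.denom - 1 = - (a * P) := by linear_combination hab
  rw [h1]
  exact Dvd.intro_left (-(x ^ 2 + x).denom * a * ((b * x.denom + 1) * x.num ^ 2 + x.num * x.denom)) (by ring)

lemma ev_div (θ : AlgebraicClosure Fq) {a b : Fq[X]} (hb : aeval θ b ≠ 0) :
    ev θ (algebraMap Fq[X] (RatFunc Fq) a / algebraMap Fq[X] (RatFunc Fq) b) =
      aeval θ a / aeval θ b := by
  have hb0 : b ≠ 0 := by rintro rfl; simp at hb
  have hdn : algebraMap Fq[X] (RatFunc Fq) b ≠ 0 := RatFunc.algebraMap_ne_zero hb0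
  rw [eq_div_iff hb]
  have h1 : (algebraMap Fq[X] (RatFunc Fq) a / algebraMap Fq[X] (RatFunc Fq) b).denom.eval₂
      (algebraMap Fq (AlgebraicClosure Fq)) θ ≠ 0 := by
    intro h0
    exact hb (Polynomial.eval₂_eq_zero_of_dvd_of_eval₂_eq_zero _ θ (RatFunc.denom_div_dvd a b) h0)
  have h2 : (algebraMap Fq[X] (RatFunc Fq) b).denom.eval₂
      (algebraMap Fq (AlgebraicClosure Fq)) θ ≠ 0 := by simp
  have h3 := RatFunc.eval_mul _ _ h1 h2
  rw [div_mul_cancel₀ _ hdn, RatFunc.eval_algebraMap, RatFunc.eval_algebraMap] at h3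
  exact h3.symm

/-- The multiset version of the residue argument. -/
lemma residue_core {K : Type} [Field K] (s : Multiset K) (N : K[X]) (m : ℕ)
    (hN : N.natDegree ≤ m) (hs : ∀ θ ∈ s, N.eval θ ≠ 0)
    (hp : ∀ j < m, (s.map fun θ => θ ^ j / N.eval θ).sum = 0) :
    N ∣ derivative (s.map fun θ => X - C θ).prod := by
  classical
  set f := (s.map fun θ => X - C θ).prod with hf
  let g : K → K[X] := fun θ => ((s.erase θ).map fun θ => X - C θ).prod
  have hg : ∀ θ ∈ s, (X - C θ) * g θ = f := fun θ hθ => by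
    rw [hf, ← Multiset.cons_erase hθ, Multiset.map_cons, Multiset.prod_cons]
  have hfm : f.Monic := monic_multiset_prod_of_monic _ _ fun θ _ => monic_X_sub_C θ
  by_cases hs0 : s = 0
  · simp [hf, hs0]
  have hfd : f.natDegree = Multiset.card s := by rw [hf, natDegree_multiset_prod_X_sub_C_eq_card]
  have hcpos : 0 < Multiset.card s := Multiset.card_pos.mpr hs0
  have hgd : ∀ θ ∈ s, (g θ).degree < f.degree := fun θ hθ => by
    rw [← hg θ hθ, degree_mul, degree_X_sub_C]
    have hgm : (g θ).Monic := monic_multiset_prod_of_monic _ _ fun θ _ => monic_X_sub_C θ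
    rw [degree_eq_natDegree hgm.ne_zero]
    norm_cast; omega
  let w : ℕ → K[X] := fun j => (s.map fun θ => C (θ ^ j / N.eval θ) * g θ).sum
  have hlt : ∀ (c : K → K), (s.map fun θ => C (c θ) * g θ).sum.degree < f.degree := by
    intro c
    rw [degree_eq_natDegree hfm.ne_zero, ← mem_degreeLT]
    refine multiset_sum_mem _ fun z hz => ?_
    obtain ⟨θ, hθ, rfl⟩ := Multiset.mem_map.mp hz
    rw [← smul_eq_C_mul]
    refine Submodule.smul_mem _ _ ?_
    rw [mem_degreeLT, ← degree_eq_natDegree hfm.ne_zero]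
    exact hgd θ hθ
  have hstep : ∀ j < m, w (j + 1) = X * w j := by
    intro j hj
    have h1 : X * w j - w (j + 1) = (s.map fun θ => C (θ ^ j / N.eval θ) * f).sum := by
      simp only [w]
      rw [← Multiset.sum_map_mul_left, ← Multiset.sum_map_sub]
      refine congrArg _ (Multiset.map_congr rfl fun θ hθ => ?_)
      rw [← hg θ hθ, pow_succ, mul_div_right_comm, C_mul]; ring
    rw [Multiset.sum_map_mul_right] at h1
    have h2 : (s.map fun θ => C (θ ^ j / N.eval θ)).sum = C ((s.map fun θ => θ ^ j / N.eval θ).sum) := by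
      rw [map_multiset_sum, Multiset.map_map]; rfl
    rw [h2, hp j hj, C_0, zero_mul, sub_eq_zero] at h1
    exact h1.symm
  have hw : ∀ j ≤ m, w j = X ^ j * w 0 := by
    intro j
    induction j with
    | zero => simp
    | succ j ih => intro hj; rw [hstep j hj, ih (by omega), pow_succ]; ring
  have hNw : (N * w 0).degree < f.degree := by
    have h1 : (w m).degree < f.degree := hlt _
    rw [hw m le_rfl, degree_mul, degree_X_pow] at h1
    rw [degree_mul]
    exact lt_of_le_of_lt (add_le_add_left (degree_le_of_natDegree_le hN) _) h1
  have hder : derivative f = (s.map fun θ => g θ).sum := by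
    rw [hf, derivative_prod]; simp [g]
  have hdvd : f ∣ N * w 0 - derivative f := by
    rw [hder]
    simp only [w]
    rw [← Multiset.sum_map_mul_left, ← Multiset.sum_map_sub]
    refine Multiset.dvd_sum ?_
    intro z hz
    obtain ⟨θ, hθ, rfl⟩ := Multiset.mem_map.mp hz
    have : N * (C (θ ^ 0 / N.eval θ) * g θ) - g θ = C (1 / N.eval θ) * ((N - C (N.eval θ)) * g θ) := by
      have : C (1 / N.eval θ) * C (N.eval θ) = (1 : K[X]) := by
        rw [← C_mul, one_div_mul_cancel (hs θ hθ), C_1]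
      rw [pow_zero]
      linear_combination (g θ) * this
    rw [this, ← hg θ hθ]
    exact Dvd.dvd.mul_left (mul_dvd_mul_right (X_sub_C_dvd_sub_C_eval) _) _
  have hzero : N * w 0 - derivative f = 0 := by
    refine eq_zero_of_dvd_of_degree_lt hdvd ?_
    refine lt_of_le_of_lt (degree_sub_le _ _) (max_lt hNw ?_)
    exact degree_derivative_lt hfm.ne_zero
  exact ⟨w 0, (sub_eq_zero.mp hzero).symm⟩

/-- nondegeneracy of tau -/
lemma tau_nondeg [CharP Fq 2] {k : ℕ} (hk : Fintype.card Fq = 2 ^ k) (p : AlgebraicClosure Fq)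
    (h : ∀ ω : Fq, tau k (algebraMap Fq _ ω * p) = 0) : p = 0 := by
  classical
  have hk1 : k ≠ 0 := by
    rintro rfl
    have := Fintype.one_lt_card (α := Fq)
    omega
  obtain ⟨k, rfl⟩ := Nat.exists_eq_succ_of_ne_zero hk1
  let F : (AlgebraicClosure Fq)[X] := ∑ i ∈ Finset.range (k+1), C (p ^ 2 ^ i) * X ^ (2 ^ i)
  have hF : F = 0 := by
    refine eq_zero_of_natDegree_lt_card_of_eval_eq_zero F (algebraMap Fq (AlgebraicClosure Fq)).injective ?_ ?_
    · intro ω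
      rw [← h ω]
      simp only [F, tau, eval_finsetSum, eval_mul, eval_C, eval_pow, eval_X, mul_pow]
      exact Finset.sum_congr rfl fun i _ => mul_comm _ _
    · rw [hk]
      refine lt_of_le_of_lt (natDegree_sum_le_of_forall_le (n := 2 ^ k) _ _ ?_)
        (Nat.pow_lt_pow_right (by norm_num) (Nat.lt_succ_self k))
      intro i hi
      refine (natDegree_C_mul_X_pow_le _ _).trans (Nat.pow_le_pow_right (by norm_num) ?_)
      have := Finset.mem_range.mp hi
      omega
  have h1 : F.coeff 1 = p := by
    simp only [F, finsetSum_coeff, coeff_C_mul_X_pow]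
    rw [Finset.sum_eq_single 0]
    · simp
    · intro i _ hi
      rw [if_neg]
      intro h1
      have : 1 < 2 ^ i := Nat.one_lt_two_pow hi
      omega
    · simp
  rw [← h1, hF, coeff_zero]

/-- If all `ω T^j / N` are killed then `N ∣ f'`. -/
lemma dvd_derivative_of_trivial [CharP Fq 2] {f N : Fq[X]} (hm : f.Monic) (hc : IsCoprime f N)
    (h : ∀ D : Fq[X], D.degree < N.degree →
      quadSym (algebraMap Fq[X] (RatFunc Fq) D / algebraMap Fq[X] (RatFunc Fq) N) f = 1) :
    N ∣ derivative f := by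
  classical
  obtain ⟨k, hk⟩ := card_eq_two_pow (Fq := Fq)
  have hN0 : ∀ θ ∈ f.aroots (AlgebraicClosure Fq), aeval θ N ≠ 0 := by
    intro θ hθ h0
    obtain ⟨a, b, hab⟩ := hc
    have := congrArg (aeval θ) hab
    rw [map_add, map_mul, map_mul, (mem_aroots.mp hθ).2, h0] at this
    simp at this
  have key := residue_core (f.aroots (AlgebraicClosure Fq)) (N.map (algebraMap Fq _)) N.natDegree
    (natDegree_map _).le (fun θ hθ => by
      rw [eval_map_algebraMap]
      exact hN0 θ hθ) ?_
  · have hsp : ((f.aroots (AlgebraicClosure Fq)).map fun θ => X - C θ).prod = f.map (algebraMap Fq _) := by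
      exact ((IsAlgClosed.splits _).eq_prod_roots_of_monic (hm.map _)).symm
    rw [hsp, derivative_map, map_dvd_map' ] at key
    exact key
  · intro j hj
    refine tau_nondeg hk _ fun ω => ?_
    have h1 := h (C ω * X ^ j) (by
      refine lt_of_le_of_lt (degree_C_mul_X_pow_le _ _) ?_
      rw [degree_eq_natDegree (by rintro rfl; simp at hj)]
      exact_mod_cast hj)
    obtain ⟨s1, s2⟩ := symbol_eq hk hm (coprime_denom_div (a := C ω * X ^ j) hc)
    rw [s1] at h1
    have h2 : tau k (lam f (algebraMap Fq[X] (RatFunc Fq) (C ω * X ^ j) / algebraMap Fq[X] (RatFunc Fq) N)) = 0 := by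
      by_contra hne
      rw [if_neg hne] at h1
      norm_num at h1
    rw [← h2, lam]
    congr 1
    rw [← Multiset.sum_map_mul_left]
    refine congrArg _ (Multiset.map_congr rfl fun θ hθ => ?_)
    rw [ev_div θ (hN0 θ hθ), eval_map_algebraMap]
    simp [mul_div_assoc]
end symbol2
end EvenChar

namespace EvenChar
section symbol3
set_option linter.unusedSectionVars false
variable {Fq : Type} [Field Fq] [Fintype Fq]

lemma exists_sqrt_mod [CharP Fq 2] {P : Fq[X]} (hm : P.Monic) (hP : Irreducible P) (a : Fq[X]) :
    ∃ b : Fq[X], b.degree < P.degree ∧ P ∣ b ^ 2 - a := by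
  have hf : Fact (Irreducible P) := ⟨hP⟩
  have : FiniteDimensional Fq (AdjoinRoot P) := (AdjoinRoot.powerBasis hP.ne_zero).finite
  have : Finite (AdjoinRoot P) := Module.finite_of_finite Fq
  have : CharP (AdjoinRoot P) 2 := charP_of_injective_algebraMap (algebraMap Fq (AdjoinRoot P)).injective 2
  obtain ⟨y, hy⟩ := surjective_frobenius (AdjoinRoot P) 2 (AdjoinRoot.mk P a)
  obtain ⟨b, rfl⟩ := AdjoinRoot.mk_surjective y
  refine ⟨b %ₘ P, degree_modByMonic_lt b hm, ?_⟩
  rw [← AdjoinRoot.mk_eq_zero, map_sub, map_pow, AdjoinRoot.mk_eq_mk.mpr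
    (show P ∣ b %ₘ P - b from ?_), ← hy, frobenius_def, sub_self]
  exact ⟨-(b /ₘ P), by linear_combination modByMonic_add_div b P⟩

lemma prime_pow_trivial [CharP Fq 2] {f P : Fq[X]} (hfm : f.Monic) (hm : P.Monic)
    (hP : Irreducible P) (hc : IsCoprime f P) (e : ℕ)
    (h : ∀ i < e, ∀ a : Fq[X], a.degree < P.degree →
      quadSym (algebraMap Fq[X] (RatFunc Fq) a / algebraMap Fq[X] (RatFunc Fq) P ^ (2 * i + 1)) f = 1)
    (j : ℕ) (hj : j ≤ 2 * e) : ∀ a : Fq[X], a.degree < (P ^ j).degree →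
      quadSym (algebraMap Fq[X] (RatFunc Fq) a / algebraMap Fq[X] (RatFunc Fq) P ^ j) f = 1 := by
  have hPn : algebraMap Fq[X] (RatFunc Fq) P ≠ 0 := RatFunc.algebraMap_ne_zero hP.ne_zero
  have hcd : ∀ (a : Fq[X]) (j : ℕ), IsCoprime f
      (algebraMap Fq[X] (RatFunc Fq) a / algebraMap Fq[X] (RatFunc Fq) P ^ j).denom := by
    intro a j
    rw [← map_pow]
    exact coprime_denom_div (IsCoprime.pow_right hc)
  have hPd : 0 < P.natDegree := hP.natDegree_pos
  have mon : ∀ (a : Fq[X]) (i : ℕ), 1 ≤ i → a.degree < P.degree → a.degree < (P ^ i).degree := by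
    intro a i hi ha
    refine lt_of_lt_of_le ha ?_
    rw [degree_pow]
    rw [degree_eq_natDegree hP.ne_zero]
    rw [nsmul_eq_mul]
    exact_mod_cast Nat.le_mul_of_pos_left _ hi
  induction j using Nat.strong_induction_on with
  | _ j ih =>
  intro a ha
  rcases Nat.eq_zero_or_pos j with rfl | hjpos
  · have : a = 0 := by
      rw [pow_zero, degree_one] at ha
      exact degree_eq_bot.mp (Nat.WithBot.lt_zero_iff.mp ha)
    subst this
    have := quadSym_wp hfm (x := 0) (by rw [RatFunc.denom_zero]; exact isCoprime_one_right)
    simpa using this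
  -- split
  have hsplit : algebraMap Fq[X] (RatFunc Fq) a / algebraMap Fq[X] (RatFunc Fq) P ^ j =
      algebraMap Fq[X] (RatFunc Fq) (a /ₘ P) / algebraMap Fq[X] (RatFunc Fq) P ^ (j - 1) +
      algebraMap Fq[X] (RatFunc Fq) (a %ₘ P) / algebraMap Fq[X] (RatFunc Fq) P ^ j := by
    obtain ⟨i, rfl⟩ : ∃ i, j = i + 1 := ⟨j - 1, by omega⟩
    conv_lhs => rw [← modByMonic_add_div a P]
    rw [map_add, map_mul, Nat.add_sub_cancel, pow_succ]
    field_simp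
    ring
  rw [hsplit, quadSym_add hfm (hcd _ _) (hcd _ _)]
  have h1 : quadSym (algebraMap Fq[X] (RatFunc Fq) (a /ₘ P) / algebraMap Fq[X] (RatFunc Fq) P ^ (j - 1)) f = 1 := by
    refine ih (j - 1) (by omega) (by omega) _ ?_
    by_cases h0 : a /ₘ P = 0
    · rw [h0, degree_zero]; exact bot_lt_iff_ne_bot.mpr (by
        rw [Ne, degree_eq_bot]; exact pow_ne_zero _ hP.ne_zero)
    · have ha0 : a ≠ 0 := by rintro rfl; simp at h0
      have h2 := natDegree_divByMonic a hm
      have h3 : a.natDegree < j * P.natDegree := by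
        have := natDegree_lt_natDegree ha0 ha
        rwa [natDegree_pow] at this
      rw [degree_eq_natDegree h0, degree_eq_natDegree (pow_ne_zero _ hP.ne_zero), natDegree_pow, h2]
      have h4 : P.natDegree ≤ a.natDegree := by
        by_contra hlt
        exact h0 ((divByMonic_eq_zero_iff hm).mpr (degree_lt_degree (by omega)))
      have : j * P.natDegree = (j - 1) * P.natDegree + P.natDegree := by
        conv_lhs => rw [show j = (j - 1) + 1 by omega]
        ring
      exact_mod_cast (by omega)
  rw [h1, one_mul]
  have ha0 := degree_modByMonic_lt a hm
  set a0 := a %ₘ P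
  rcases Nat.even_or_odd' j with ⟨i, hi | hi⟩
  · obtain ⟨b, hb, r, hr⟩ := exists_sqrt_mod hm hP a0
    have hrd : r.degree < P.degree := by
      have h2 : (P * r).degree < P.degree + P.degree := by
        rw [← hr]
        refine lt_of_le_of_lt (degree_sub_le _ _) (max_lt ?_ ?_)
        · rw [sq, degree_mul]
          by_cases hb0 : b = 0
          · rw [hb0, degree_eq_natDegree hP.ne_zero]; simp
          · rw [degree_eq_natDegree hb0, degree_eq_natDegree hP.ne_zero]
            have := natDegree_lt_natDegree hb0 hb
            exact_mod_cast (by omega)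
        · refine lt_of_lt_of_le ha0 ?_
          rw [degree_eq_natDegree hP.ne_zero]; exact_mod_cast (by omega)
      rw [degree_mul] at h2
      exact lt_of_add_lt_add_left h2
    have hsgn : ∀ z : RatFunc Fq, -z = z := fun z => by
      have : CharP (RatFunc Fq) 2 := charP_of_injective_algebraMap (algebraMap Fq (RatFunc Fq)).injective 2
      exact CharTwo.neg_eq z
    have he : algebraMap Fq[X] (RatFunc Fq) a0 / algebraMap Fq[X] (RatFunc Fq) P ^ j =
        (((algebraMap Fq[X] (RatFunc Fq) b / algebraMap Fq[X] (RatFunc Fq) P ^ i) ^ 2 +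
          (algebraMap Fq[X] (RatFunc Fq) b / algebraMap Fq[X] (RatFunc Fq) P ^ i)) +
        algebraMap Fq[X] (RatFunc Fq) b / algebraMap Fq[X] (RatFunc Fq) P ^ i) +
        algebraMap Fq[X] (RatFunc Fq) r / algebraMap Fq[X] (RatFunc Fq) P ^ (j - 1) := by
      have h2 : algebraMap Fq[X] (RatFunc Fq) a0 = algebraMap Fq[X] (RatFunc Fq) b ^ 2 -
          algebraMap Fq[X] (RatFunc Fq) P * algebraMap Fq[X] (RatFunc Fq) r := by
        rw [← map_pow, ← map_mul, ← map_sub, ← hr]; congr 1; ring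
      rw [← hsgn (algebraMap Fq[X] (RatFunc Fq) r / _)]
      nth_rewrite 3 [← hsgn (algebraMap Fq[X] (RatFunc Fq) b / _)]
      rw [h2, add_neg_cancel_right, ← sub_eq_add_neg, sub_div, div_pow, ← pow_mul, hi, mul_comm i 2]
      congr 1
      rw [show 2 * i = (2 * i - 1) + 1 by omega, pow_succ, Nat.add_sub_cancel]
      field_simp
    have hi1 : 1 ≤ i := by omega
    rw [he, quadSym_add hfm ?_ (hcd _ _), quadSym_add hfm ?_ (hcd _ _), quadSym_wp hfm (hcd _ _),
      ih i (by omega) (by omega) b (mon b i hi1 hb), ih (j - 1) (by omega) (by omega) r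
        (mon r _ (by omega) hrd)]
    · norm_num
    · refine coprime_denom_add ?_ (hcd _ _)
      rw [sq]; exact coprime_denom_mul (hcd _ _) (hcd _ _)
    · refine coprime_denom_add (coprime_denom_add ?_ (hcd _ _)) (hcd _ _)
      rw [sq]; exact coprime_denom_mul (hcd _ _) (hcd _ _)
  · rw [hi]
    exact h i (by omega) a0 ha0

lemma prime_pow_dvd_derivative [CharP Fq 2] {f P : Fq[X]} (hfm : f.Monic) (hm : P.Monic)
    (hP : Irreducible P) (hc : IsCoprime f P) (e : ℕ)
    (h : ∀ i < e, ∀ a : Fq[X], a.degree < P.degree →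
      quadSym (algebraMap Fq[X] (RatFunc Fq) a / algebraMap Fq[X] (RatFunc Fq) P ^ (2 * i + 1)) f = 1) :
    P ^ (2 * e) ∣ derivative f := by
  refine dvd_derivative_of_trivial hfm (IsCoprime.pow_right hc) fun D hD => ?_
  rw [map_pow]
  exact prime_pow_trivial hfm hm hP hc e h _ le_rfl D hD

lemma sq_of_derivative_zero [CharP Fq 2] {f : Fq[X]} (hfm : f.Monic) (h : derivative f = 0) :
    ∃ l : Fq[X], l.Monic ∧ f = l ^ 2 := by
  have h1 := expand_contract 2 h (by norm_num)
  obtain ⟨g, hg⟩ : ∃ g : Fq[X], g.map (frobenius Fq 2) = contract 2 f := by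
    exact map_surjective (frobenius Fq 2) (surjective_frobenius Fq 2) _
  have h2 : f = g ^ 2 := by
    rw [← h1, ← hg, ← map_expand, map_frobenius_expand]
  refine ⟨g, ?_, h2⟩
  have h3 : g.leadingCoeff ^ 2 = 1 := by
    rw [← leadingCoeff_pow, ← h2]; exact hfm
  have : (g.leadingCoeff + 1) ^ 2 = 0 := by
    rw [CharTwo.add_sq, h3, one_pow, CharTwo.add_self_eq_zero]
  exact CharTwo.add_eq_zero.mp (pow_eq_zero_iff (by norm_num) |>.mp this)
end symbol3
end EvenChar

namespace EvenChar
section comb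
set_option linter.unusedSectionVars false

/-- monic irreducible polynomials -/
abbrev Pr (Fq : Type) [Field Fq] := {P : Polynomial Fq // P.Monic ∧ Irreducible P}

variable {Fq : Type} [Field Fq] [Fintype Fq]

open scoped Classical in
/-- degree of an effective divisor -/
def wt (e : Pr Fq →₀ ℕ) : ℕ := e.sum fun P k => k * P.1.natDegree

/-- the monic polynomial attached to an effective divisor -/
def mon (e : Pr Fq →₀ ℕ) : Fq[X] := e.prod fun P k => P.1 ^ k

lemma mon_add (a b : Pr Fq →₀ ℕ) : mon (a + b) = mon a * mon b := by
  classical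
  exact Finsupp.prod_add_index' (fun _ => pow_zero _) (fun _ _ _ => pow_add _ _ _)

lemma wt_add (a b : Pr Fq →₀ ℕ) : wt (a + b) = wt a + wt b := by
  classical
  exact Finsupp.sum_add_index' (fun _ => by simp) (fun _ _ _ => by ring)

lemma mon_single (P : Pr Fq) (k : ℕ) : mon (Finsupp.single P k) = P.1 ^ k := by
  simp [mon]

lemma wt_single (P : Pr Fq) (k : ℕ) : wt (Finsupp.single P k) = k * P.1.natDegree := by
  simp [wt]

lemma wt_mono {a b : Pr Fq →₀ ℕ} (h : a ≤ b) : wt a ≤ wt b := by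
  obtain ⟨c, rfl⟩ := exists_add_of_le h
  rw [wt_add]; omega

lemma mon_monic (e : Pr Fq →₀ ℕ) : (mon e).Monic :=
  monic_prod_of_monic _ _ fun P _ => P.2.1.pow _

lemma natDegree_mon (e : Pr Fq →₀ ℕ) : (mon e).natDegree = wt e := by
  rw [mon, wt, Finsupp.prod, Finsupp.sum, natDegree_prod_of_monic]
  · simp
  · exact fun P _ => P.2.1.pow _

lemma pr_coprime {P Q : Pr Fq} (h : P ≠ Q) : IsCoprime P.1 Q.1 := by
  rw [P.2.2.coprime_iff_not_dvd]
  intro hd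
  exact h (Subtype.ext (eq_of_monic_of_associated P.2.1 Q.2.1 (P.2.2.associated_of_dvd Q.2.2 hd)))

lemma pow_dvd_mon {P : Pr Fq} {e : Pr Fq →₀ ℕ} {k : ℕ} : P.1 ^ k ∣ mon e ↔ k ≤ e P := by
  classical
  have h1 : mon e = P.1 ^ (e P) * mon (e.erase P) := by
    conv_lhs => rw [← Finsupp.single_add_erase P e]
    rw [mon_add, mon_single]
  have h2 : IsCoprime P.1 (mon (e.erase P)) := by
    refine IsCoprime.prod_right fun Q hQ => IsCoprime.pow_right (pr_coprime ?_)
    rintro rfl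
    simp at hQ
  constructor
  · intro h
    rw [h1] at h
    have h3 := (IsCoprime.pow_left h2).dvd_of_dvd_mul_right h
    exact (pow_dvd_pow_iff P.2.2.ne_zero P.2.2.not_isUnit).mp h3
  · intro h
    rw [h1]
    exact Dvd.dvd.mul_right (pow_dvd_pow _ h) _

lemma dvd_mon {P : Pr Fq} {e : Pr Fq →₀ ℕ} : P.1 ∣ mon e ↔ P ∈ e.support := by
  have := pow_dvd_mon (P := P) (e := e) (k := 1)
  rw [pow_one] at this
  rw [this, Finsupp.mem_support_iff]; omega

lemma mon_injective : Function.Injective (mon : (Pr Fq →₀ ℕ) → Fq[X]) := by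
  intro a b h
  ext P
  refine le_antisymm ?_ ?_
  · rw [← pow_dvd_mon, ← h, pow_dvd_mon]
  · rw [← pow_dvd_mon, h, pow_dvd_mon]

lemma mon_surj {f : Fq[X]} (hf : f.Monic) : ∃ e : Pr Fq →₀ ℕ, mon e = f := by
  classical
  have hprod : (normalizedFactors f).prod = f := by
    rw [prod_normalizedFactors_eq hf.ne_zero, hf.normalize_eq_self]
  have key : ∀ s : Multiset Fq[X], (∀ P ∈ s, P.Monic ∧ Irreducible P) →
      ∃ e : Pr Fq →₀ ℕ, mon e = s.prod := by
    intro s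
    induction s using Multiset.induction_on with
    | empty => intro _; exact ⟨0, by simp [mon]⟩
    | cons P s ih =>
      intro h
      obtain ⟨e, he⟩ := ih (fun Q hQ => h Q (Multiset.mem_cons_of_mem hQ))
      refine ⟨Finsupp.single ⟨P, h P (Multiset.mem_cons_self _ _)⟩ 1 + e, ?_⟩
      rw [mon_add, mon_single, he, Multiset.prod_cons, pow_one]
  rw [← hprod]
  refine key _ fun P hP => ?_
  have hirr := irreducible_of_normalized_factor P hP
  refine ⟨?_, hirr⟩
  rw [← normalize_normalized_factor P hP]; exact monic_normalize hirr.ne_zero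

instance finLT (n : ℕ) : Finite (degreeLT Fq n) :=
  Finite.of_injective _ (degreeLTEquiv Fq n).injective

lemma low_finite (n : ℕ) : {p : Fq[X] | p.degree < n}.Finite := by
  have : {p : Fq[X] | p.degree < n} = (degreeLT Fq n : Set Fq[X]) := by
    ext p; simp [mem_degreeLT]
  rw [this]
  exact Set.finite_coe_iff.mp (finLT n)

variable (Fq) in
/-- polynomials of degree `< n` -/
def low (n : ℕ) : Finset Fq[X] := (low_finite (Fq := Fq) n).toFinset

lemma mem_low {n : ℕ} {p : Fq[X]} : p ∈ low Fq n ↔ p.degree < n := by simp [low]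

lemma card_low (n : ℕ) : (low Fq n).card = Fintype.card Fq ^ n := by
  have h : Nat.card (degreeLT Fq n) = Fintype.card Fq ^ n := by
    rw [Nat.card_congr (degreeLTEquiv Fq n).toEquiv]; simp
  rw [← h, low, ← Set.ncard_eq_toFinset_card _ (low_finite n)]
  rw [← Nat.card_coe_set_eq]
  exact Nat.card_congr (Equiv.subtypeEquivRight fun p => by simp [mem_degreeLT])

lemma zero_mem_low (n : ℕ) : (0 : Fq[X]) ∈ low Fq n := by
  rw [mem_low, degree_zero]; exact WithBot.bot_lt_coe n

lemma add_mem_low {n : ℕ} {a b : Fq[X]} (ha : a ∈ low Fq n) (hb : b ∈ low Fq n) :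
    a + b ∈ low Fq n := by
  rw [mem_low] at *
  exact lt_of_le_of_lt (degree_add_le _ _) (max_lt ha hb)

open scoped Classical in
variable (Fq) in
/-- monic polynomials of degree `n` -/
def Mon (n : ℕ) : Finset Fq[X] := (low Fq n).image (fun p => X ^ n + p)

lemma mem_Mon {n : ℕ} {f : Fq[X]} : f ∈ Mon Fq n ↔ f.Monic ∧ f.natDegree = n := by
  classical
  rw [Mon, Finset.mem_image]
  constructor
  · rintro ⟨p, hp, rfl⟩
    rw [mem_low] at hp
    refine ⟨monic_X_pow_add hp, ?_⟩
    exact natDegree_eq_of_degree_eq_some (by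
      rw [degree_add_eq_left_of_degree_lt (by rwa [degree_X_pow]), degree_X_pow])
  · rintro ⟨h1, h2⟩
    refine ⟨f - X ^ n, ?_, by ring⟩
    rw [mem_low, ← h2, ← degree_eq_natDegree h1.ne_zero]
    refine degree_sub_lt_left ?_ h1.ne_zero ?_
    · rw [degree_X_pow, degree_eq_natDegree h1.ne_zero]
    · simp [h1.leadingCoeff]

lemma card_Mon (n : ℕ) : (Mon Fq n).card = Fintype.card Fq ^ n := by
  classical
  rw [Mon, Finset.card_image_of_injective _ (add_right_injective _), card_low]

lemma ES_finite (n : ℕ) : {e : Pr Fq →₀ ℕ | wt e = n}.Finite := by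
  refine Set.Finite.of_finite_image (f := mon) ?_ mon_injective.injOn
  refine (Mon Fq n).finite_toSet.subset ?_
  rintro _ ⟨e, he, rfl⟩
  exact mem_Mon.mpr ⟨mon_monic e, by rw [natDegree_mon]; exact he⟩

variable (Fq) in
/-- effective divisors of degree `n` -/
def ES (n : ℕ) : Finset (Pr Fq →₀ ℕ) := (ES_finite (Fq := Fq) n).toFinset

lemma mem_ES {n : ℕ} {e : Pr Fq →₀ ℕ} : e ∈ ES Fq n ↔ wt e = n := by simp [ES]

lemma card_ES (n : ℕ) : (ES Fq n).card = Fintype.card Fq ^ n := by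
  rw [← card_Mon]
  refine Finset.card_bij (fun e _ => mon e) ?_ (fun a _ b _ h => mon_injective h) ?_
  · intro e he
    exact mem_Mon.mpr ⟨mon_monic e, by rw [natDegree_mon]; exact mem_ES.mp he⟩
  · intro f hf
    obtain ⟨h1, h2⟩ := mem_Mon.mp hf
    obtain ⟨e, rfl⟩ := mon_surj h1
    exact ⟨e, mem_ES.mpr (by rw [← natDegree_mon, h2]), rfl⟩

open scoped Classical in
lemma card_ES_ge {n : ℕ} {e0 : Pr Fq →₀ ℕ} (h : wt e0 ≤ n) :
    ((ES Fq n).filter (fun e => e0 ≤ e)).card = Fintype.card Fq ^ (n - wt e0) := by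
  rw [← card_ES]
  symm
  refine Finset.card_bij (fun e _ => e0 + e) ?_ (fun a _ b _ h => add_left_cancel h) ?_
  · intro e he
    rw [mem_ES] at he
    rw [Finset.mem_filter, mem_ES, wt_add]
    exact ⟨by omega, le_self_add⟩
  · intro f hf
    obtain ⟨h1, h2⟩ := Finset.mem_filter.mp hf
    obtain ⟨e, rfl⟩ := exists_add_of_le h2
    rw [mem_ES, wt_add] at h1
    exact ⟨e, mem_ES.mpr (by omega), rfl⟩

lemma wt_eq_sum {e : Pr Fq →₀ ℕ} : wt e = ∑ P ∈ e.support, e P * P.1.natDegree := rfl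

open scoped Classical in
lemma card_Iic_le (e : Pr Fq →₀ ℕ) : (Finset.Iic e).card ≤ 2 ^ wt e := by
  rw [Finsupp.card_Iic, wt_eq_sum, ← Finset.prod_pow_eq_pow_sum]
  refine Finset.prod_le_prod' fun P _ => ?_
  rw [Nat.card_Iic]
  have h1 : e P + 1 ≤ 2 ^ (e P) := Nat.lt_two_pow_self
  exact h1.trans (Nat.pow_le_pow_right (by norm_num) (Nat.le_mul_of_pos_right _ P.2.2.natDegree_pos))

/-- Divisors `e` with `P^(2 e_P) ∣ h` lie below a fixed divisor of small degree. -/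
lemma exists_half {h : Fq[X]} (hh : h ≠ 0) : ∃ H : Pr Fq →₀ ℕ, 2 * wt H ≤ h.natDegree ∧
    ∀ e : Pr Fq →₀ ℕ, (∀ P ∈ e.support, P.1 ^ (2 * e P) ∣ h) → e ≤ H := by
  classical
  obtain ⟨E, hE⟩ := mon_surj (monic_mul_leadingCoeff_inv hh)
  refine ⟨E.mapRange (· / 2) (by simp), ?_, ?_⟩
  · have h1 : wt E = h.natDegree := by
      rw [← natDegree_mon, hE, natDegree_mul_leadingCoeff_inv _ hh]
    have h2 : E.mapRange (· / 2) (by simp) + E.mapRange (· / 2) (by simp) ≤ E := by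
      intro P
      simp only [Finsupp.add_apply, Finsupp.mapRange_apply]
      omega
    have h3 := wt_mono h2
    rw [wt_add] at h3
    omega
  · intro e he P
    by_cases hP : P ∈ e.support
    · have h1 : P.1 ^ (2 * e P) ∣ mon E := by
        rw [hE]; exact Dvd.dvd.mul_right (he P hP) _
      rw [pow_dvd_mon] at h1
      simp only [Finsupp.mapRange_apply]
      omega
    · rw [Finsupp.notMem_support_iff.mp hP]; exact Nat.zero_le _
end comb
end EvenChar

namespace EvenChar
section coords
set_option linter.unusedSectionVars false

variable {Fq : Type} [Field Fq] [Fintype Fq]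

/-- coordinates of a partial fraction decomposition -/
abbrev Co (Fq : Type) [Field Fq] := (Σ _ : Pr Fq, ℕ) →₀ Fq[X]

/-- all coordinates have small degree -/
def Good (c : Co Fq) : Prop := ∀ p, c p ∈ low Fq p.1.1.natDegree

/-- index set -/
def sE (e : Pr Fq →₀ ℕ) : Finset (Σ _ : Pr Fq, ℕ) := e.support.sigma fun P => Finset.range (e P)

lemma mem_sE {e : Pr Fq →₀ ℕ} {p : Σ _ : Pr Fq, ℕ} : p ∈ sE e ↔ p.2 < e p.1 := by
  rw [sE, Finset.mem_sigma, Finset.mem_range, Finsupp.mem_support_iff]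
  omega

open scoped Classical in
/-- exponents -/
def ex (c : Co Fq) : Pr Fq →₀ ℕ := c.support.sup fun p => Finsupp.single p.1 (p.2 + 1)

lemma ex_le_iff {c : Co Fq} {e : Pr Fq →₀ ℕ} : ex c ≤ e ↔ ∀ p, c p ≠ 0 → p.2 < e p.1 := by
  classical
  rw [ex, Finset.sup_le_iff]
  refine forall_congr' fun p => ?_
  rw [Finsupp.mem_support_iff, Finsupp.single_le_iff, Nat.succ_le_iff]

lemma lt_ex {c : Co Fq} {p} (h : c p ≠ 0) : p.2 < ex c p.1 := ex_le_iff.mp le_rfl p h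

lemma ex_top {c : Co Fq} {P : Pr Fq} (h : ex c P ≠ 0) : c ⟨P, ex c P - 1⟩ ≠ 0 := by
  classical
  intro h0
  have h1 : ex c ≤ ex c - Finsupp.single P 1 := by
    rw [ex_le_iff]
    rintro ⟨Q, i⟩ hp
    have h2 := lt_ex hp
    rw [Finsupp.tsub_apply]
    by_cases hQ : P = Q
    · subst hQ
      rw [Finsupp.single_eq_same]
      by_contra h3
      have h4 : i = ex c P - 1 := by simp only at h2 h3; omega
      subst h4
      exact hp h0
    · rw [Finsupp.single_eq_of_ne' hQ]; simpa using h2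
  have h2 := h1 P
  rw [Finsupp.tsub_apply, Finsupp.single_eq_same] at h2
  omega

lemma ex_zero_iff {c : Co Fq} : ex c = 0 ↔ c = 0 := by
  constructor
  · intro h
    ext1 p
    by_contra h1
    have := lt_ex h1
    rw [h] at this
    simp at this
  · rintro rfl
    simp [ex]
    rfl

/-- decompositions with exponents at most `e` -/
def VV (e : Pr Fq →₀ ℕ) : Finset (Co Fq) :=
  (sE e).finsupp fun p => low Fq p.1.1.natDegree

lemma mem_VV {e : Pr Fq →₀ ℕ} {c : Co Fq} : c ∈ VV e ↔ Good c ∧ ex c ≤ e := by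
  rw [VV, Finset.mem_finsupp_iff, ex_le_iff]
  constructor
  · rintro ⟨h1, h2⟩
    have h3 : ∀ p, c p ≠ 0 → p ∈ sE e := fun p hp => h1 (Finsupp.mem_support_iff.mpr hp)
    refine ⟨fun p => ?_, fun p hp => mem_sE.mp (h3 p hp)⟩
    by_cases hp : c p = 0
    · rw [hp]; exact zero_mem_low _
    · exact h2 p (h3 p hp)
  · rintro ⟨h1, h2⟩
    exact ⟨fun p hp => mem_sE.mpr (h2 p (Finsupp.mem_support_iff.mp hp)), fun p _ => h1 p⟩

lemma card_VV (e : Pr Fq →₀ ℕ) : (VV e).card = Fintype.card Fq ^ wt e := by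
  rw [VV, Finset.card_finsupp, sE, Finset.prod_sigma, wt_eq_sum, ← Finset.prod_pow_eq_pow_sum]
  refine Finset.prod_congr rfl fun P _ => ?_
  simp only [card_low, Finset.prod_const, Finset.card_range]
  rw [← pow_mul, mul_comm]

open scoped Classical in
/-- decompositions with exponents exactly `e` -/
def XX (e : Pr Fq →₀ ℕ) : Finset (Co Fq) :=
  (sE e).finsupp fun p => if p.2 + 1 = e p.1 then (low Fq p.1.1.natDegree).erase 0
    else low Fq p.1.1.natDegree

lemma mem_XX {e : Pr Fq →₀ ℕ} {c : Co Fq} : c ∈ XX e ↔ Good c ∧ ex c = e := by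
  classical
  have key : c ∈ XX e ↔ c ∈ VV e ∧ ∀ p ∈ sE e, p.2 + 1 = e p.1 → c p ≠ 0 := by
    rw [XX, VV, Finset.mem_finsupp_iff, Finset.mem_finsupp_iff, and_assoc, ← forall₂_and]
    refine and_congr_right fun _ => forall₂_congr fun p hp => ?_
    split_ifs with h
    · simp [h, and_comm]
    · simp [h]
  rw [key, mem_VV, and_assoc]
  refine and_congr_right fun _ => ?_
  constructor
  · rintro ⟨h1, h2⟩
    refine le_antisymm h1 fun P => ?_
    by_contra hlt
    push Not at hlt
    have h3 := h2 ⟨P, e P - 1⟩ (mem_sE.mpr (by simp only; omega)) (by simp only; omega)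
    have h4 := lt_ex h3
    simp only at h4
    omega
  · rintro rfl
    refine ⟨le_rfl, ?_⟩
    rintro ⟨P, i⟩ hp h
    rw [mem_sE] at hp
    simp only at hp h
    have := ex_top (c := c) (P := P) (by omega)
    rwa [show ex c P - 1 = i by omega] at this

lemma card_XX (e : Pr Fq →₀ ℕ) : ((XX e).card : ℝ) = ∏ P ∈ e.support,
    (((Fintype.card Fq : ℝ) ^ P.1.natDegree) ^ e P -
      ((Fintype.card Fq : ℝ) ^ P.1.natDegree) ^ (e P - 1)) := by
  classical
  rw [XX, Finset.card_finsupp, sE, Finset.prod_sigma, Nat.cast_prod]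
  refine Finset.prod_congr rfl fun P hP => ?_
  obtain ⟨k, hk⟩ : ∃ k, e P = k + 1 := ⟨e P - 1, by
    rw [Finsupp.mem_support_iff] at hP; omega⟩
  rw [hk, Finset.prod_range_succ]
  have h1 : ∀ i ∈ Finset.range k, (if i + 1 = e P then (low Fq P.1.natDegree).erase 0
    else low Fq P.1.natDegree).card = Fintype.card Fq ^ P.1.natDegree := by
    intro i hi
    rw [Finset.mem_range] at hi
    rw [if_neg (by omega), card_low]
  simp only [hk] at h1 ⊢
  rw [Finset.prod_congr rfl h1]
  rw [if_pos trivial, Finset.card_erase_of_mem (zero_mem_low _), card_low]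
  rw [Finset.prod_const, Finset.card_range]
  have : 1 ≤ Fintype.card Fq ^ P.1.natDegree := Nat.one_le_pow _ _ Fintype.card_pos
  push_cast [Nat.cast_sub this]
  ring

open scoped Classical in
variable (Fq) in
/-- decompositions of total degree `n` -/
def CC (n : ℕ) : Finset (Co Fq) := (ES Fq n).biUnion XX

lemma mem_CC {n : ℕ} {c : Co Fq} : c ∈ CC Fq n ↔ Good c ∧ wt (ex c) = n := by
  classical
  rw [CC, Finset.mem_biUnion]
  constructor
  · rintro ⟨e, he, hc⟩
    obtain ⟨h1, rfl⟩ := mem_XX.mp hc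
    exact ⟨h1, mem_ES.mp he⟩
  · rintro ⟨h1, h2⟩
    exact ⟨ex c, mem_ES.mpr h2, mem_XX.mpr ⟨h1, rfl⟩⟩

lemma sum_CC {M : Type*} [AddCommMonoid M] (n : ℕ) (F : Co Fq → M) :
    ∑ c ∈ CC Fq n, F c = ∑ e ∈ ES Fq n, ∑ c ∈ XX e, F c := by
  classical
  rw [CC, Finset.sum_biUnion]
  intro a _ b _ hab
  rw [Function.onFun, Finset.disjoint_left]
  intro c h1 h2
  exact hab ((mem_XX.mp h1).2.symm.trans (mem_XX.mp h2).2)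

open scoped Classical in
variable (Fq) in
/-- decompositions of total degree at most `n` -/
def DD (n : ℕ) : Finset (Co Fq) := (Finset.range (n + 1)).biUnion (CC Fq)

lemma mem_DD {n : ℕ} {c : Co Fq} : c ∈ DD Fq n ↔ Good c ∧ wt (ex c) ≤ n := by
  classical
  rw [DD, Finset.mem_biUnion]
  constructor
  · rintro ⟨j, hj, hc⟩
    rw [mem_CC] at hc
    rw [Finset.mem_range] at hj
    exact ⟨hc.1, by omega⟩
  · rintro ⟨h1, h2⟩
    exact ⟨_, Finset.mem_range.mpr (by omega), mem_CC.mpr ⟨h1, rfl⟩⟩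

/-- sum over all the spaces `VV e` -/
def WW (n : ℕ) (F : Co Fq → ℤ) : ℤ := ∑ e ∈ ES Fq n, ∑ c ∈ VV e, F c

lemma WW_eq (n : ℕ) (F : Co Fq → ℤ) :
    WW n F = ∑ c ∈ DD Fq n, (Fintype.card Fq : ℤ) ^ (n - wt (ex c)) * F c := by
  classical
  have h1 : ∀ e ∈ ES Fq n, ∑ c ∈ VV e, F c =
      ∑ c ∈ DD Fq n, if ex c ≤ e then F c else 0 := by
    intro e he
    rw [← Finset.sum_filter]
    refine Finset.sum_congr ?_ fun _ _ => rfl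
    ext c
    rw [mem_VV, Finset.mem_filter, mem_DD]
    constructor
    · rintro ⟨a, b⟩
      exact ⟨⟨a, (wt_mono b).trans (mem_ES.mp he).le⟩, b⟩
    · rintro ⟨⟨a, _⟩, b⟩
      exact ⟨a, b⟩
  rw [WW, Finset.sum_congr rfl h1, Finset.sum_comm]
  refine Finset.sum_congr rfl fun c hc => ?_
  rw [← Finset.sum_filter, Finset.sum_const, card_ES_ge (mem_DD.mp hc).2, nsmul_eq_mul]
  push_cast
  rfl

lemma CC_zero (F : Co Fq → ℤ) : ∑ c ∈ CC Fq 0, F c = WW 0 F := by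
  classical
  rw [WW_eq]
  have : DD Fq 0 = CC Fq 0 := by
    ext c; rw [mem_DD, mem_CC]; simp
  rw [this]
  refine Finset.sum_congr rfl fun c hc => ?_
  simp

lemma CC_succ (n : ℕ) (F : Co Fq → ℤ) :
    ∑ c ∈ CC Fq (n + 1), F c = WW (n + 1) F - Fintype.card Fq * WW n F := by
  classical
  rw [WW_eq, WW_eq]
  have : DD Fq (n + 1) = DD Fq n ∪ CC Fq (n + 1) := by
    ext c; rw [Finset.mem_union, mem_DD, mem_DD, mem_CC, ← and_or_left, Nat.le_succ_iff]
  rw [this, Finset.sum_union]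
  · rw [Finset.mul_sum]
    have h1 : ∑ c ∈ DD Fq n, (Fintype.card Fq : ℤ) ^ (n + 1 - wt (ex c)) * F c =
        ∑ c ∈ DD Fq n, (Fintype.card Fq : ℤ) * ((Fintype.card Fq : ℤ) ^ (n - wt (ex c)) * F c) := by
      refine Finset.sum_congr rfl fun c hc => ?_
      rw [show n + 1 - wt (ex c) = (n - wt (ex c)) + 1 by have := (mem_DD.mp hc).2; omega]
      ring
    have h2 : ∑ c ∈ CC Fq (n + 1), (Fintype.card Fq : ℤ) ^ (n + 1 - wt (ex c)) * F c =
        ∑ c ∈ CC Fq (n + 1), F c := by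
      refine Finset.sum_congr rfl fun c hc => ?_
      rw [(mem_CC.mp hc).2]; simp
    rw [h1, h2]; ring
  · rw [Finset.disjoint_left]
    intro c h1 h2
    rw [mem_DD] at h1
    rw [mem_CC] at h2
    omega

/-- the rational function attached to coordinates -/
def Ph (c : Co Fq) : RatFunc Fq := c.sum fun p a =>
  algebraMap Fq[X] (RatFunc Fq) a / algebraMap Fq[X] (RatFunc Fq) p.1.1 ^ (2 * p.2 + 1)

lemma Ph_add (a b : Co Fq) : Ph (a + b) = Ph a + Ph b := by
  classical
  exact Finsupp.sum_add_index' (fun _ => by simp) (fun _ _ _ => by rw [map_add, add_div])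

lemma Ph_neg (a : Co Fq) : Ph (-a) = - Ph a := by
  have := Ph_add a (-a)
  rw [add_neg_cancel] at this
  have h0 : Ph (0 : Co Fq) = 0 := by simp [Ph]
  rw [h0] at this
  exact (neg_eq_of_add_eq_zero_right this.symm).symm

lemma Ph_single (p : Σ _ : Pr Fq, ℕ) (a : Fq[X]) : Ph (Finsupp.single p a) =
    algebraMap Fq[X] (RatFunc Fq) a / algebraMap Fq[X] (RatFunc Fq) p.1.1 ^ (2 * p.2 + 1) := by
  simp [Ph]

lemma coprime_denom_zero {f : Fq[X]} : IsCoprime f (0 : RatFunc Fq).denom := by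
  rw [RatFunc.denom_zero]; exact isCoprime_one_right

lemma coprime_denom_sum {ι : Type*} {f : Fq[X]} (s : Finset ι) (u : ι → RatFunc Fq)
    (h : ∀ i ∈ s, IsCoprime f (u i).denom) : IsCoprime f (∑ i ∈ s, u i).denom := by
  classical
  induction s using Finset.induction_on with
  | empty => simpa using coprime_denom_zero (Fq := Fq)
  | insert a s ha ih =>
    rw [Finset.sum_insert ha]
    exact coprime_denom_add (h _ (Finset.mem_insert_self _ _))
      (ih fun i hi => h i (Finset.mem_insert_of_mem hi))

lemma coprime_denom_sum_iff {f : Fq[X]} {u v : RatFunc Fq} (hv : IsCoprime f v.denom) :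
    IsCoprime f (u + v).denom ↔ IsCoprime f u.denom := by
  constructor
  · intro h
    have := coprime_denom_add h (coprime_denom_neg hv)
    rwa [add_neg_cancel_right] at this
  · intro h
    exact coprime_denom_add h hv

lemma coprime_Ph {f : Fq[X]} {c : Co Fq} (h : ∀ P ∈ (ex c).support, ¬ P.1 ∣ f) :
    IsCoprime f (Ph c).denom := by
  rw [Ph, Finsupp.sum]
  refine coprime_denom_sum _ _ fun p hp => ?_
  rw [← map_pow]
  refine coprime_denom_div (IsCoprime.pow_right (IsCoprime.symm ?_))
  rw [p.1.2.2.coprime_iff_not_dvd]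
  refine h _ ?_
  have := lt_ex (Finsupp.mem_support_iff.mp hp)
  rw [Finsupp.mem_support_iff]
  omega

/-- Poles are where they should be. -/
lemma not_coprime_Ph {c : Co Fq} (hg : Good c) {P : Pr Fq} (hP : P ∈ (ex c).support) :
    ¬ IsCoprime P.1 (Ph c).denom := by
  classical
  intro hcop
  rw [Finsupp.mem_support_iff] at hP
  have htop := ex_top hP
  set m := ex c P - 1 with hm
  have hP0 : algebraMap Fq[X] (RatFunc Fq) P.1 ≠ 0 := by
    rw [Ne, FaithfulSMul.algebraMap_eq_zero_iff]; exact P.2.2.ne_zero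
  have h1 : IsCoprime P.1 (Ph c * algebraMap Fq[X] (RatFunc Fq) (P.1 ^ (2 * m))).denom :=
    coprime_denom_mul hcop coprime_denom_poly
  rw [Ph, Finsupp.sum, Finset.sum_mul, ← Finset.add_sum_erase _ _
    (Finsupp.mem_support_iff.mpr htop), coprime_denom_sum_iff] at h1
  · have h2 : algebraMap Fq[X] (RatFunc Fq) (c ⟨P, m⟩) / algebraMap Fq[X] (RatFunc Fq) P.1 ^ (2 * m + 1)
        * algebraMap Fq[X] (RatFunc Fq) (P.1 ^ (2 * m)) =
        algebraMap Fq[X] (RatFunc Fq) (c ⟨P, m⟩) / algebraMap Fq[X] (RatFunc Fq) P.1 := by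
      rw [map_pow, pow_succ]; field_simp
    simp only at h1
    rw [h2] at h1
    set u := algebraMap Fq[X] (RatFunc Fq) (c ⟨P, m⟩) / algebraMap Fq[X] (RatFunc Fq) P.1 with hu
    have h3 : algebraMap Fq[X] (RatFunc Fq) (u.num * P.1) =
        algebraMap Fq[X] (RatFunc Fq) (c ⟨P, m⟩ * u.denom) := by
      have hd : algebraMap Fq[X] (RatFunc Fq) u.denom ≠ 0 := by
        rw [Ne, FaithfulSMul.algebraMap_eq_zero_iff]; exact u.denom_ne_zero
      have h4 := RatFunc.num_div_denom u
      nth_rw 3 [hu] at h4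
      rw [div_eq_div_iff hd hP0] at h4
      rw [map_mul, map_mul, h4]
    have h4 := RatFunc.algebraMap_injective Fq h3
    have h5 : P.1 ∣ c ⟨P, m⟩ * u.denom := ⟨u.num, by rw [← h4, mul_comm]⟩
    have h6 := h1.dvd_of_dvd_mul_right h5
    have h7 := hg ⟨P, m⟩
    rw [mem_low] at h7
    refine htop (eq_zero_of_dvd_of_degree_lt h6 ?_)
    rwa [degree_eq_natDegree P.2.2.ne_zero]
  · refine coprime_denom_sum _ _ fun p hp => ?_
    obtain ⟨hp1, hp2⟩ := Finset.mem_erase.mp hp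
    obtain ⟨Q, i⟩ := p
    by_cases hQ : P = Q
    · subst hQ
      have h3 := lt_ex (Finsupp.mem_support_iff.mp hp2)
      simp only at h3
      have h4 : i ≠ m := by rintro rfl; exact hp1 rfl
      obtain ⟨d, hd⟩ : ∃ d, 2 * m = 2 * i + 1 + d := ⟨2 * m - (2 * i + 1), by omega⟩
      have h5 : algebraMap Fq[X] (RatFunc Fq) (c ⟨P, i⟩) /
          algebraMap Fq[X] (RatFunc Fq) P.1 ^ (2 * i + 1)
        * algebraMap Fq[X] (RatFunc Fq) (P.1 ^ (2 * m)) =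
        algebraMap Fq[X] (RatFunc Fq) (c ⟨P, i⟩ * P.1 ^ d) := by
        rw [hd, map_pow, map_mul, map_pow, pow_add _ (2 * i + 1)]; field_simp
      simp only
      rw [h5]
      exact coprime_denom_poly
    · refine coprime_denom_mul ?_ coprime_denom_poly
      rw [← map_pow]
      exact coprime_denom_div (IsCoprime.pow_right (pr_coprime hQ))

lemma coprime_Ph_iff {f : Fq[X]} {c : Co Fq} (hg : Good c) {G : Fq[X]} :
    IsCoprime f (Ph c + algebraMap Fq[X] (RatFunc Fq) G).denom ↔
      ∀ P ∈ (ex c).support, ¬ P.1 ∣ f := by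
  rw [coprime_denom_sum_iff coprime_denom_poly]
  constructor
  · intro h P hP hd
    exact not_coprime_Ph hg hP (h.of_isCoprime_of_dvd_left hd)
  · exact coprime_Ph

lemma Good.sub {a b : Co Fq} (ha : Good a) (hb : Good b) : Good (a - b) := by
  intro p
  have h1 := ha p
  have h2 := hb p
  rw [mem_low] at *
  rw [Finsupp.sub_apply]
  exact lt_of_le_of_lt (degree_sub_le _ _) (max_lt h1 h2)

lemma Good.add {a b : Co Fq} (ha : Good a) (hb : Good b) : Good (a + b) := by
  intro p
  rw [Finsupp.add_apply]
  exact add_mem_low (ha p) (hb p)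

lemma Ph_inj {a b : Co Fq} (ha : Good a) (hb : Good b) {G H : Fq[X]}
    (h : Ph a + algebraMap Fq[X] (RatFunc Fq) G = Ph b + algebraMap Fq[X] (RatFunc Fq) H) :
    a = b ∧ G = H := by
  have hab : a = b := by
    have h1 : Ph (a - b) + algebraMap Fq[X] (RatFunc Fq) (G - H) = 0 := by
      rw [sub_eq_add_neg a b, Ph_add, Ph_neg, map_sub]
      linear_combination h
    rw [← sub_eq_zero, ← ex_zero_iff, ← Finsupp.support_eq_empty, Finset.eq_empty_iff_forall_notMem]
    intro P hP
    have h2 : IsCoprime P.1 (Ph (a - b) + algebraMap Fq[X] (RatFunc Fq) (G - H)).denom := by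
      rw [h1]; exact coprime_denom_zero
    exact (coprime_Ph_iff (ha.sub hb)).mp h2 P hP dvd_rfl
  subst hab
  exact ⟨rfl, RatFunc.algebraMap_injective Fq (add_left_cancel h)⟩
end coords
end EvenChar

namespace EvenChar
section famimg
set_option linter.unusedSectionVars false

variable {Fq : Type} [Field Fq] [Fintype Fq]

lemma Ph_eq_sum {e : Pr Fq →₀ ℕ} {c : Co Fq} (h : ex c ≤ e) :
    Ph c = ∑ P ∈ e.support, ∑ i ∈ Finset.range (e P),
      algebraMap Fq[X] (RatFunc Fq) (c ⟨P, i⟩) / algebraMap Fq[X] (RatFunc Fq) P.1 ^ (2 * i + 1) := by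
  classical
  rw [Ph, Finsupp.sum_of_support_subset (s := sE e), sE, Finset.sum_sigma]
  · intro p hp
    exact mem_sE.mpr (ex_le_iff.mp h p (Finsupp.mem_support_iff.mp hp))
  · intro i _; simp

lemma sum_Icc_shift {M : Type*} [AddCommMonoid M] (m : ℕ) (g : ℕ → M) :
    ∑ i ∈ Finset.Icc 1 m, g i = ∑ i ∈ Finset.range m, g (i + 1) := by
  induction m with
  | zero => simp
  | succ m ih => rw [Finset.sum_Icc_succ_top (by omega), ih, Finset.sum_range_succ]

lemma Ffam_eq (n : ℕ) : Ffam Fq n = Ph '' (CC Fq n : Set (Co Fq)) := by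
  classical
  ext u
  constructor
  · rintro ⟨S, e, a, hS, he, hdeg, htop, hsum, rfl⟩
    let E : Pr Fq →₀ ℕ := Finsupp.onFinset (S.subtype (fun P => P.Monic ∧ Irreducible P))
      (fun P => if P.1 ∈ S then e P.1 else 0) (by
        intro P h; rw [Finset.mem_subtype]; by_contra h1; exact h (if_neg h1))
    have hE : ∀ P : Pr Fq, E P = if P.1 ∈ S then e P.1 else 0 := fun P => rfl
    have hEs : E.support = S.subtype (fun P => P.Monic ∧ Irreducible P) := by
      ext P
      rw [Finsupp.mem_support_iff, Finset.mem_subtype, hE]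
      constructor
      · intro h; by_contra h1; exact h (if_neg h1)
      · intro h; rw [if_pos h]; have := he _ h; omega
    let c : Co Fq := Finsupp.onFinset (sE E)
      (fun p => if p.2 < E p.1 then a p.1.1 (p.2 + 1) else 0) (by
        intro p h; rw [mem_sE]; by_contra h1; exact h (if_neg h1))
    have hc : ∀ p, c p = if p.2 < E p.1 then a p.1.1 (p.2 + 1) else 0 := fun p => rfl
    clear_value E c
    have hcX : c ∈ XX E := by
      rw [mem_XX]
      constructor
      · intro p
        rw [hc]
        split_ifs with h
        · rw [hE] at h
          split_ifs at h with h2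
          · rw [mem_low, ← degree_eq_natDegree p.1.2.2.ne_zero]
            exact hdeg _ h2 _ (by omega) (by omega)
          · omega
        · exact zero_mem_low _
      · refine le_antisymm (ex_le_iff.mpr fun p hp => ?_) fun P => ?_
        · rw [hc] at hp
          by_contra h; exact hp (if_neg h)
        · by_contra hlt
          push Not at hlt
          have h1 : P.1 ∈ S := by
            by_contra h; rw [hE, if_neg h] at hlt; omega
          have h2 : E P = e P.1 := by rw [hE, if_pos h1]
          have h3 : c ⟨P, E P - 1⟩ ≠ 0 := by
            rw [hc, if_pos (by simp only; omega)]
            simp only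
            rw [h2, Nat.sub_add_cancel (he _ h1)]
            exact htop _ h1
          have := lt_ex h3
          simp only at this
          omega
    refine ⟨c, ?_, ?_⟩
    · rw [Finset.mem_coe, mem_CC]
      obtain ⟨h1, h2⟩ := mem_XX.mp hcX
      refine ⟨h1, ?_⟩
      rw [h2, wt_eq_sum, hEs, ← hsum]
      rw [← Finset.sum_subtype_of_mem (fun P => e P * P.natDegree)
        (s := S) (fun P hP => hS P hP)]
      refine Finset.sum_congr rfl fun P hP => ?_
      rw [hE, if_pos (Finset.mem_subtype.mp hP)]
    · rw [Ph_eq_sum (mem_XX.mp hcX).2.le, hEs]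
      rw [← Finset.sum_subtype_of_mem (fun P => ∑ i ∈ Finset.Icc 1 (e P),
            algebraMap (Polynomial Fq) (RatFunc Fq) (a P i) /
              algebraMap (Polynomial Fq) (RatFunc Fq) P ^ (2 * i - 1))
        (s := S) (fun P hP => hS P hP)]
      refine Finset.sum_congr rfl fun P hP => ?_
      rw [Finset.mem_subtype] at hP
      have h2 : E P = e P.1 := by rw [hE, if_pos hP]
      rw [h2]
      rw [sum_Icc_shift]
      refine Finset.sum_congr rfl fun i hi => ?_
      rw [Finset.mem_range] at hi
      rw [hc, if_pos (by simp only; omega)]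
      rw [show 2 * (i + 1) - 1 = 2 * i + 1 by omega]
  · rintro ⟨c, hc, rfl⟩
    rw [Finset.mem_coe, mem_CC] at hc
    obtain ⟨hg, hw⟩ := hc
    let e : Fq[X] → ℕ := fun P => if h : P.Monic ∧ Irreducible P then ex c ⟨P, h⟩ else 0
    let a : Fq[X] → ℕ → Fq[X] := fun P i =>
      if h : P.Monic ∧ Irreducible P then c ⟨⟨P, h⟩, i - 1⟩ else 0
    have he : ∀ P : Pr Fq, e P.1 = ex c P := fun P => dif_pos P.2
    have ha : ∀ (P : Pr Fq) i, a P.1 i = c ⟨P, i - 1⟩ := fun P i => dif_pos P.2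
    clear_value e a
    refine ⟨(ex c).support.map (Function.Embedding.subtype _), e, a, ?_, ?_, ?_, ?_, ?_, ?_⟩
    · intro P hP
      obtain ⟨P, _, rfl⟩ := Finset.mem_map.mp hP
      exact P.2
    · intro P hP
      obtain ⟨P, h, rfl⟩ := Finset.mem_map.mp hP
      rw [Finsupp.mem_support_iff] at h
      simp only [Function.Embedding.subtype_apply]
      rw [he]; omega
    · intro P hP i h1 h2
      obtain ⟨P, h, rfl⟩ := Finset.mem_map.mp hP
      simp only [Function.Embedding.subtype_apply]
      rw [ha, degree_eq_natDegree P.2.2.ne_zero]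
      exact mem_low.mp (hg ⟨P, i - 1⟩)
    · intro P hP
      obtain ⟨P, h, rfl⟩ := Finset.mem_map.mp hP
      simp only [Function.Embedding.subtype_apply]
      rw [ha, he]
      exact ex_top (Finsupp.mem_support_iff.mp h)
    · rw [Finset.sum_map, ← hw, wt_eq_sum]
      exact Finset.sum_congr rfl fun P _ => by simp only [Function.Embedding.subtype_apply, he]
    · rw [Finset.sum_map, Ph_eq_sum le_rfl]
      refine Finset.sum_congr rfl fun P _ => ?_
      simp only [Function.Embedding.subtype_apply, he, ha]
      rw [sum_Icc_shift]
      refine Finset.sum_congr rfl fun i hi => ?_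
      rw [show 2 * (i + 1) - 1 = 2 * i + 1 by omega, Nat.add_sub_cancel]
end famimg

section bound
set_option linter.unusedSectionVars false

variable {Fq : Type} [Field Fq] [Fintype Fq]

lemma abs_quadSym_le [CharP Fq 2] {f : Fq[X]} (hm : f.Monic) (u : RatFunc Fq) :
    |quadSym u f| ≤ 1 := by
  by_cases h : IsCoprime f u.denom
  · rcases quadSym_pm hm h with h | h <;> rw [h] <;> simp
  · rw [quadSym_not h]; simp

open scoped Classical in
lemma sum_VV_filter [CharP Fq 2] {f : Fq[X]} (e : Pr Fq →₀ ℕ) :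
    ∑ c ∈ VV e, quadSym (Ph c) f = ∑ c ∈ VV (e.filter fun P => ¬ P.1 ∣ f), quadSym (Ph c) f := by
  symm
  refine Finset.sum_subset ?_ ?_
  · intro c hc
    rw [mem_VV] at *
    refine ⟨hc.1, hc.2.trans fun P => ?_⟩
    rw [Finsupp.filter_apply]
    split_ifs <;> omega
  · intro c h1 h2
    refine quadSym_not fun hcop => h2 ?_
    rw [mem_VV] at *
    refine ⟨h1.1, fun P => ?_⟩
    by_cases hP : P ∈ (ex c).support
    · rw [Finsupp.filter_apply_pos]
      · exact h1.2 P
      · intro hd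
        exact not_coprime_Ph h1.1 hP (hcop.of_isCoprime_of_dvd_left hd)
    · rw [Finsupp.notMem_support_iff.mp hP]; omega

lemma VV_add {e : Pr Fq →₀ ℕ} {a b : Co Fq} (ha : a ∈ VV e) (hb : b ∈ VV e) : a + b ∈ VV e := by
  rw [mem_VV] at *
  refine ⟨ha.1.add hb.1, ?_⟩
  have h1 := ex_le_iff.mp ha.2
  have h2 := ex_le_iff.mp hb.2
  rw [ex_le_iff]
  intro p hp
  by_cases h : a p = 0
  · refine h2 p fun h' => hp ?_
    rw [Finsupp.add_apply, h, h', add_zero]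
  · exact h1 p h

lemma neg_mem_VV {e : Pr Fq →₀ ℕ} {a : Co Fq} (ha : a ∈ VV e) : -a ∈ VV e := by
  rw [mem_VV] at *
  refine ⟨fun p => ?_, ?_⟩
  · have := ha.1 p
    rw [mem_low] at *
    rwa [Finsupp.neg_apply, degree_neg]
  · rw [ex_le_iff]
    intro p hp
    refine ex_le_iff.mp ha.2 p fun h => hp ?_
    rw [Finsupp.neg_apply, h, neg_zero]

lemma sum_VV_zero [CharP Fq 2] {f : Fq[X]} (hm : f.Monic) {e : Pr Fq →₀ ℕ}
    (he : ∀ P ∈ e.support, ¬ P.1 ∣ f)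
    (hne : ∑ c ∈ VV e, quadSym (Ph c) f ≠ 0) : ∀ P ∈ e.support, P.1 ^ (2 * e P) ∣ derivative f := by
  classical
  have hcop : ∀ c ∈ VV e, IsCoprime f (Ph c).denom := by
    intro c hc
    refine coprime_Ph fun P hP => he P ?_
    have := (mem_VV.mp hc).2 P
    rw [Finsupp.mem_support_iff] at *
    omega
  have htriv : ∀ c ∈ VV e, quadSym (Ph c) f = 1 := by
    intro c0 hc0
    by_contra h1
    have h2 : quadSym (Ph c0) f = -1 := (quadSym_pm hm (hcop c0 hc0)).resolve_left h1
    have h3 : ∑ c ∈ VV e, quadSym (Ph c) f = ∑ c ∈ VV e, quadSym (Ph (c + c0)) f := by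
      symm
      refine Finset.sum_bij (fun c _ => c + c0) (fun c hc => VV_add hc hc0)
        (fun a _ b _ h => add_right_cancel h) ?_ (fun _ _ => rfl)
      intro b hb
      exact ⟨b + -c0, VV_add hb (neg_mem_VV hc0), by simp⟩
    have h4 : ∑ c ∈ VV e, quadSym (Ph (c + c0)) f = ∑ c ∈ VV e, - quadSym (Ph c) f := by
      refine Finset.sum_congr rfl fun c hc => ?_
      rw [Ph_add, quadSym_add hm (hcop c hc) (hcop c0 hc0), h2]; ring
    rw [h4, Finset.sum_neg_distrib] at h3
    omega
  intro P hP
  refine prime_pow_dvd_derivative hm P.2.1 P.2.2 ?_ _ fun i hi a ha => ?_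
  · exact ((P.2.2.coprime_iff_not_dvd).mpr (he P hP)).symm
  · have := htriv (Finsupp.single ⟨P, i⟩ a) ?_
    · rwa [Ph_single] at this
    · rw [mem_VV, ex_le_iff]
      constructor
      · intro p
        by_cases hp : (⟨P, i⟩ : Σ _ : Pr Fq, ℕ) = p
        · subst hp
          rw [Finsupp.single_eq_same, mem_low, ← degree_eq_natDegree P.2.2.ne_zero]; exact ha
        · rw [Finsupp.single_eq_of_ne' hp]; exact zero_mem_low _
      · intro p hp
        by_cases h : (⟨P, i⟩ : Σ _ : Pr Fq, ℕ) = p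
        · subst h; exact hi
        · exact absurd (Finsupp.single_eq_of_ne' h) hp

lemma WW_bound [CharP Fq 2] {f : Fq[X]} (hm : f.Monic) (hd : derivative f ≠ 0) {N : ℕ}
    (hN : (derivative f).natDegree ≤ 2 * N) (n : ℕ) :
    |WW n (fun c : Co Fq => quadSym (Ph c) f)| ≤ 2 ^ N * (Fintype.card Fq : ℤ) ^ n := by
  classical
  obtain ⟨H, hH1, hH2⟩ := exists_half hd
  let fl : (Pr Fq →₀ ℕ) → (Pr Fq →₀ ℕ) := fun e => e.filter fun P => ¬ P.1 ∣ f
  have hfl : ∀ e, fl e ≤ e := by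
    intro e P
    simp only [fl]
    rw [Finsupp.filter_apply]
    split_ifs <;> omega
  have h1 : ∀ e, |∑ c ∈ VV e, quadSym (Ph c) f| ≤
      ∑ d ∈ Finset.Iic H, if fl e = d then (Fintype.card Fq : ℤ) ^ wt d else 0 := by
    intro e
    rw [Finset.sum_ite_eq, sum_VV_filter]
    split_ifs with h
    · refine (Finset.abs_sum_le_sum_abs _ _).trans ?_
      refine (Finset.sum_le_sum fun c _ => abs_quadSym_le hm _).trans ?_
      rw [Finset.sum_const, card_VV]
      simp [fl]
    · rw [abs_nonpos_iff]
      by_contra hne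
      refine h (Finset.mem_Iic.mpr (hH2 _ (sum_VV_zero hm ?_ hne)))
      intro P hP
      rw [Finsupp.support_filter, Finset.mem_filter] at hP
      exact hP.2
  rw [WW]
  refine (Finset.abs_sum_le_sum_abs _ _).trans ?_
  refine (Finset.sum_le_sum fun e _ => h1 e).trans ?_
  rw [Finset.sum_comm]
  have h2 : ∀ d ∈ Finset.Iic H, (∑ e ∈ ES Fq n,
      if fl e = d then (Fintype.card Fq : ℤ) ^ wt d else 0) ≤ (Fintype.card Fq : ℤ) ^ n := by
    intro d _
    rw [← Finset.sum_filter, Finset.sum_const, nsmul_eq_mul]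
    by_cases hdn : wt d ≤ n
    · have h3 : ((ES Fq n).filter fun e => fl e = d).card ≤ Fintype.card Fq ^ (n - wt d) := by
        rw [← card_ES_ge hdn]
        refine Finset.card_le_card ?_
        intro e he
        rw [Finset.mem_filter] at *
        exact ⟨he.1, he.2 ▸ hfl e⟩
      calc _ ≤ ((Fintype.card Fq ^ (n - wt d) : ℕ) : ℤ) * (Fintype.card Fq : ℤ) ^ wt d := by
            gcongr
        _ = _ := by
            push_cast
            rw [← pow_add, Nat.sub_add_cancel hdn]
    · have h3 : ((ES Fq n).filter fun e => fl e = d) = ∅ := by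
        rw [Finset.filter_eq_empty_iff]
        intro e he h
        have := wt_mono (hfl e)
        rw [h, mem_ES.mp he] at this
        exact hdn this
      rw [h3]
      simp
  refine (Finset.sum_le_sum h2).trans ?_
  rw [Finset.sum_const, nsmul_eq_mul]
  gcongr
  calc ((Finset.Iic H).card : ℤ) ≤ ((2 ^ wt H : ℕ) : ℤ) := by exact_mod_cast card_Iic_le H
    _ = 2 ^ wt H := by push_cast; rfl
    _ ≤ 2 ^ N := by
      refine pow_le_pow_right₀ (by norm_num) ?_
      omega

lemma CC_bound [CharP Fq 2] {f : Fq[X]} (hm : f.Monic) (hd : derivative f ≠ 0) {N : ℕ}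
    (hN : (derivative f).natDegree ≤ 2 * N) (n : ℕ) :
    |∑ c ∈ CC Fq n, quadSym (Ph c) f| ≤ 2 * 2 ^ N * (Fintype.card Fq : ℤ) ^ n := by
  cases n with
  | zero =>
    rw [CC_zero]
    have := WW_bound hm hd hN 0
    have h2 : (0 : ℤ) < 2 ^ N := by positivity
    refine this.trans ?_
    simp
  | succ n =>
    rw [CC_succ]
    have h1 := WW_bound hm hd hN n
    have h2 := WW_bound hm hd hN (n + 1)
    refine (abs_sub _ _).trans ?_
    rw [abs_mul, Nat.abs_cast]
    have h3 : (Fintype.card Fq : ℤ) * |WW n (fun c : Co Fq => quadSym (Ph c) f)| ≤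
      Fintype.card Fq * (2 ^ N * (Fintype.card Fq : ℤ) ^ n) := by gcongr
    rw [pow_succ] at *
    linarith
end bound
end EvenChar

namespace EvenChar
section euler
set_option linter.unusedSectionVars false

variable {Fq : Type} [Field Fq] [Fintype Fq]

variable (Fq) in
/-- the real number `q` -/
abbrev qq : ℝ := (Fintype.card Fq : ℝ)

/-- the norm of a prime -/
def nm (P : Pr Fq) : ℝ := qq Fq ^ P.1.natDegree

lemma one_lt_qq : (1 : ℝ) < qq Fq := by
  have := Fintype.one_lt_card (α := Fq)
  exact_mod_cast this

lemma two_le_qq : (2 : ℝ) ≤ qq Fq := by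
  have := Fintype.one_lt_card (α := Fq)
  exact_mod_cast this

lemma qq_pos : (0 : ℝ) < qq Fq := zero_lt_one.trans one_lt_qq

lemma two_le_nm (P : Pr Fq) : 2 ≤ nm P := by
  have h := P.2.2.natDegree_pos
  calc (2 : ℝ) ≤ qq Fq ^ 1 := by rw [pow_one]; exact two_le_qq
    _ ≤ nm P := pow_le_pow_right₀ one_lt_qq.le h

lemma nm_pos (P : Pr Fq) : 0 < nm P := by linarith [two_le_nm P]

open scoped Classical in
/-- indicator divisor -/
def indR (R : Finset (Pr Fq)) : Pr Fq →₀ ℕ := ∑ P ∈ R, Finsupp.single P 1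

lemma indR_apply (R : Finset (Pr Fq)) (P : Pr Fq) [Decidable (P ∈ R)] :
    indR R P = if P ∈ R then 1 else 0 := by
  classical
  rw [indR, Finsupp.finsetSum_apply]
  simp [Finsupp.single_apply]

lemma indR_le {R : Finset (Pr Fq)} {e : Pr Fq →₀ ℕ} : indR R ≤ e ↔ R ⊆ e.support := by
  classical
  constructor
  · intro h P hP
    have := h P
    rw [indR_apply, if_pos hP] at this
    rw [Finsupp.mem_support_iff]; omega
  · intro h P
    rw [indR_apply]
    split_ifs with hP
    · have := Finsupp.mem_support_iff.mp (h hP); omega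
    · omega

lemma qq_pow_wt (e : Pr Fq →₀ ℕ) : qq Fq ^ wt e = ∏ P ∈ e.support, nm P ^ e P := by
  rw [wt_eq_sum, ← Finset.prod_pow_eq_pow_sum]
  refine Finset.prod_congr rfl fun P _ => ?_
  rw [nm, ← pow_mul, mul_comm]

lemma indR_support (R : Finset (Pr Fq)) : (indR R).support = R := by
  classical
  ext P; rw [Finsupp.mem_support_iff, indR_apply]; simp

lemma qq_pow_indR (R : Finset (Pr Fq)) : qq Fq ^ wt (indR R) = ∏ P ∈ R, nm P := by
  classical
  rw [qq_pow_wt, indR_support]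
  refine Finset.prod_congr rfl fun P hP => ?_
  rw [indR_apply, if_pos hP, pow_one]

open scoped Classical in
variable (Fq) in
/-- sets of primes of total degree at most `n` -/
def RR (n : ℕ) : Finset (Finset (Pr Fq)) :=
  ((Finset.range (n + 1)).biUnion (ES Fq)).image Finsupp.support

lemma mem_RR {n : ℕ} {R : Finset (Pr Fq)} : R ∈ RR Fq n ↔ wt (indR R) ≤ n := by
  classical
  rw [RR, Finset.mem_image]
  constructor
  · rintro ⟨e, he, rfl⟩
    rw [Finset.mem_biUnion] at he
    obtain ⟨j, hj, he⟩ := he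
    rw [Finset.mem_range] at hj
    have h1 := wt_mono (indR_le.mpr (Finset.Subset.refl e.support))
    rw [mem_ES] at he
    omega
  · intro h
    refine ⟨indR R, Finset.mem_biUnion.mpr ⟨_, Finset.mem_range.mpr (Nat.lt_succ_of_le h),
      mem_ES.mpr rfl⟩, indR_support R⟩

lemma RR_tendsto : Filter.Tendsto (RR Fq) Filter.atTop Filter.atTop := by
  refine Filter.tendsto_atTop_finset_of_monotone ?_ fun R => ⟨wt (indR R), mem_RR.mpr le_rfl⟩
  intro a b hab R hR
  rw [mem_RR] at *
  exact hR.trans hab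

/-- the basic sum over divisors -/
def EE (n : ℕ) (κ : Pr Fq → ℝ) : ℝ :=
  ∑ e ∈ ES Fq n, ∏ P ∈ e.support, (nm P ^ e P - κ P * nm P ^ (e P - 1))

lemma EE_eq (n : ℕ) (κ : Pr Fq → ℝ) :
    EE n κ = qq Fq ^ (2 * n) * ∑ R ∈ RR Fq n, ∏ P ∈ R, (-(κ P / nm P ^ 2)) := by
  classical
  have h1 : ∀ e ∈ ES Fq n, ∏ P ∈ e.support, (nm P ^ e P - κ P * nm P ^ (e P - 1)) =
      ∑ R ∈ RR Fq n, if indR R ≤ e then qq Fq ^ n * ∏ P ∈ R, (-(κ P / nm P)) else 0 := by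
    intro e he
    rw [← Finset.sum_filter, ← Finset.mul_sum]
    have h2 : (RR Fq n).filter (fun R => indR R ≤ e) = e.support.powerset := by
      ext R
      rw [Finset.mem_filter, Finset.mem_powerset, mem_RR, indR_le]
      constructor
      · exact fun h => h.2
      · intro h
        have := wt_mono (indR_le.mpr h)
        rw [mem_ES.mp he] at this
        exact ⟨this, h⟩
    rw [h2, ← Finset.prod_one_add, ← mem_ES.mp he, qq_pow_wt, ← Finset.prod_mul_distrib]
    refine Finset.prod_congr rfl fun P hP => ?_
    obtain ⟨k, hk⟩ : ∃ k, e P = k + 1 := ⟨e P - 1, by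
      rw [Finsupp.mem_support_iff] at hP; omega⟩
    rw [hk, Nat.add_sub_cancel, pow_succ]
    have := (nm_pos P).ne'
    field_simp
    ring
  rw [EE, Finset.sum_congr rfl h1, Finset.sum_comm, Finset.mul_sum]
  refine Finset.sum_congr rfl fun R hR => ?_
  rw [mem_RR] at hR
  rw [← Finset.sum_filter, Finset.sum_const, card_ES_ge hR, nsmul_eq_mul]
  push_cast
  have h3 : qq Fq ^ (n - wt (indR R)) = qq Fq ^ n * ∏ P ∈ R, (nm P)⁻¹ := by
    rw [Finset.prod_inv_distrib, ← qq_pow_indR, ← div_eq_mul_inv]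
    rw [pow_sub₀ _ qq_pos.ne' hR, div_eq_mul_inv]
  have h4 : ∏ P ∈ R, (-(κ P / nm P ^ 2)) = (∏ P ∈ R, (nm P)⁻¹) * ∏ P ∈ R, (-(κ P / nm P)) := by
    rw [← Finset.prod_mul_distrib]
    refine Finset.prod_congr rfl fun P _ => ?_
    have := (nm_pos P).ne'
    field_simp
  rw [h3, h4]
  ring

lemma summable_nm : Summable fun P : Pr Fq => 1 / nm P ^ 2 := by
  classical
  refine summable_of_sum_le (c := (1 - (qq Fq)⁻¹)⁻¹) (fun P => by positivity) fun R => ?_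
  have hmaps : ∀ P ∈ R, P.1.natDegree ∈ Finset.range (R.sup (fun P => P.1.natDegree) + 1) := by
    intro P hP
    rw [Finset.mem_range, Nat.lt_succ_iff]
    exact Finset.le_sup (f := fun P : Pr Fq => P.1.natDegree) hP
  rw [← Finset.sum_fiberwise_of_maps_to hmaps]
  have hq := qq_pos (Fq := Fq)
  have h1 : ∀ j ∈ Finset.range (R.sup (fun P => P.1.natDegree) + 1),
      ∑ P ∈ R with P.1.natDegree = j, 1 / nm P ^ 2 ≤ ((qq Fq)⁻¹) ^ j := by
    intro j _
    have h2 : ∀ P ∈ R.filter (fun P => P.1.natDegree = j), 1 / nm P ^ 2 = 1 / (qq Fq ^ j) ^ 2 := by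
      intro P hP
      rw [nm, (Finset.mem_filter.mp hP).2]
    rw [Finset.sum_congr rfl h2, Finset.sum_const, nsmul_eq_mul]
    have h3 : ((R.filter fun P => P.1.natDegree = j).card : ℝ) ≤ qq Fq ^ j := by
      have h4 : (R.filter fun P => P.1.natDegree = j).card ≤ (Mon Fq j).card := by
        refine Finset.card_le_card_of_injOn (fun P => P.1) ?_ (fun a _ b _ h => Subtype.ext h)
        intro P hP
        exact mem_Mon.mpr ⟨P.2.1, (Finset.mem_filter.mp hP).2⟩
      rw [card_Mon] at h4
      exact_mod_cast h4
    calc _ ≤ qq Fq ^ j * (1 / (qq Fq ^ j) ^ 2) := by gcongr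
      _ = _ := by rw [inv_pow]; field_simp
  refine (Finset.sum_le_sum h1).trans ?_
  have h5 : (qq Fq)⁻¹ < 1 := inv_lt_one_of_one_lt₀ one_lt_qq
  exact sum_le_hasSum _ (fun j _ => by positivity)
    (hasSum_geometric_of_lt_one (by positivity) h5)

lemma summable_kap {κ : Pr Fq → ℝ} (h : ∀ P, |κ P| ≤ 2) :
    Summable fun P : Pr Fq => ‖-(κ P / nm P ^ 2)‖ := by
  refine Summable.of_nonneg_of_le (fun _ => norm_nonneg _) (fun P => ?_)
    ((summable_nm (Fq := Fq)).mul_left 2)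
  have := nm_pos P
  rw [norm_neg, norm_div, Real.norm_eq_abs, Real.norm_of_nonneg (by positivity)]
  rw [mul_one_div]
  gcongr
  exact h P

lemma EE_tendsto {κ : Pr Fq → ℝ} (h : ∀ P, |κ P| ≤ 2) :
    Filter.Tendsto (fun n => EE n κ / qq Fq ^ (2 * n)) Filter.atTop
      (nhds (∏' P : Pr Fq, (1 - κ P / nm P ^ 2))) := by
  have h1 := summable_finsetProd_of_summable_norm (summable_kap h)
  have h2 := tprod_one_add h1
  simp only [← sub_eq_add_neg] at h2
  rw [h2]
  have h3 := h1.hasSum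
  rw [HasSum, SummationFilter.unconditional_filter] at h3
  refine (h3.comp RR_tendsto).congr fun n => ?_
  rw [EE_eq, mul_div_cancel_left₀]
  · rfl
  · exact (pow_pos qq_pos _).ne'

/-- weight of a set of primes -/
def ww (R : Finset (Pr Fq)) : ℝ := ∏ P ∈ R, (1 - 1 / nm P ^ 2)

lemma card_CC (n : ℕ) : ((CC Fq n).card : ℝ) = EE n (fun _ : Pr Fq => 1) := by
  classical
  have := sum_CC (Fq := Fq) n (fun _ => (1 : ℝ))
  simp only [Finset.sum_const, nsmul_eq_mul, mul_one] at this
  rw [this, EE]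
  refine Finset.sum_congr rfl fun e _ => ?_
  rw [card_XX]
  simp only [one_mul]
  rfl

lemma wsum_CC (n : ℕ) : ∑ c ∈ CC Fq n, ww (ex c).support =
    EE n (fun P : Pr Fq => 1 + 1 / nm P - 1 / nm P ^ 2) := by
  classical
  rw [sum_CC, EE]
  refine Finset.sum_congr rfl fun e _ => ?_
  have h1 : ∀ c ∈ XX e, ww (ex c).support = ww e.support := by
    intro c hc; rw [(mem_XX.mp hc).2]
  rw [Finset.sum_congr rfl h1, Finset.sum_const, nsmul_eq_mul, card_XX, ww,
    ← Finset.prod_mul_distrib]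
  refine Finset.prod_congr rfl fun P hP => ?_
  obtain ⟨k, hk⟩ : ∃ k, e P = k + 1 := ⟨e P - 1, by
    rw [Finsupp.mem_support_iff] at hP; omega⟩
  change (nm P ^ e P - nm P ^ (e P - 1)) * _ = _
  rw [hk, Nat.add_sub_cancel, pow_succ]
  have := (nm_pos P).ne'
  field_simp
  ring

variable (Fq) in
/-- normalized size limit -/
def limC : ℝ := ∏' P : Pr Fq, (1 - 1 / nm P ^ 2)
variable (Fq) in
/-- real Euler product -/
def limP : ℝ := ∏' P : Pr Fq, (1 - 1 / (nm P ^ 2 * (nm P + 1)))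

lemma card_tendsto : Filter.Tendsto (fun n => ((CC Fq n).card : ℝ) / qq Fq ^ (2 * n)) Filter.atTop
    (nhds (limC Fq)) := by
  simp only [card_CC]
  exact EE_tendsto (fun P => by norm_num)

lemma summable_P : Summable fun P : Pr Fq => ‖-(1 / (nm P ^ 2 * (nm P + 1)))‖ := by
  refine Summable.of_nonneg_of_le (fun _ => norm_nonneg _) (fun P => ?_) (summable_nm (Fq := Fq))
  have := nm_pos P
  rw [norm_neg, Real.norm_of_nonneg (by positivity)]
  gcongr
  nlinarith [pow_pos this 2]

lemma limC_ne : limC Fq ≠ 0 := by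
  have := tprod_one_add_ne_zero_of_summable (f := fun P : Pr Fq => -(1 / nm P ^ 2)) (fun P => ?_)
    (summable_kap (κ := fun _ => 1) (fun P => by norm_num))
  · simpa only [limC, ← sub_eq_add_neg] using this
  · have := two_le_nm P
    have h1 : 1 / nm P ^ 2 < 1 := by rw [div_lt_one (by positivity)]; nlinarith
    linarith

lemma limP_ne : limP Fq ≠ 0 := by
  have := tprod_one_add_ne_zero_of_summable (f := fun P : Pr Fq => -(1 / (nm P ^ 2 * (nm P + 1))))
    (fun P => ?_) summable_P
  · simpa only [limP, ← sub_eq_add_neg] using this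
  · have := two_le_nm P
    have h1 : 1 / (nm P ^ 2 * (nm P + 1)) < 1 := by
      rw [div_lt_one (by positivity)]; nlinarith
    linarith

lemma wsum_tendsto : Filter.Tendsto
    (fun n => (∑ c ∈ CC Fq n, ww (ex c).support) / qq Fq ^ (2 * n)) Filter.atTop
    (nhds (limC Fq * limP Fq)) := by
  simp only [wsum_CC]
  have h1 : limC Fq * limP Fq =
      ∏' P : Pr Fq, (1 - (1 + 1 / nm P - 1 / nm P ^ 2) / nm P ^ 2) := by
    have m1 := multipliable_one_add_of_summable (f := fun P : Pr Fq => -(1 / nm P ^ 2))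
      (summable_kap (κ := fun _ => 1) (fun P => by norm_num))
    have m2 := multipliable_one_add_of_summable
      (f := fun P : Pr Fq => -(1 / (nm P ^ 2 * (nm P + 1)))) summable_P
    simp only [← sub_eq_add_neg] at m1 m2
    rw [limC, limP, ← m1.tprod_mul m2]
    refine tprod_congr fun P => ?_
    have := nm_pos P
    field_simp
    ring
  rw [h1]
  refine EE_tendsto fun P => ?_
  have := two_le_nm P
  have h2 : 1 / nm P ≤ 1 / 2 := by gcongr
  have h3 : 0 < 1 / nm P := by positivity
  have h4 : 1 / nm P ^ 2 = (1 / nm P) ^ 2 := by rw [div_pow, one_pow]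
  rw [h4, abs_le]
  constructor <;> nlinarith

open scoped Classical in
/-- number of monic polynomials of degree `j` prime to `R` -/
def Cn (R : Finset (Pr Fq)) (j : ℕ) : ℕ := ((Mon Fq j).filter fun l => ∀ P ∈ R, ¬ P.1 ∣ l).card

lemma Cn_insert [DecidableEq (Pr Fq)] {R : Finset (Pr Fq)} {P : Pr Fq} (hP : P ∉ R) (j : ℕ) :
    Cn R j = Cn (insert P R) j +
      if P.1.natDegree ≤ j then Cn R (j - P.1.natDegree) else 0 := by
  classical
  have h0 : Cn R j = Cn (insert P R) j +
      (((Mon Fq j).filter fun l => ∀ Q ∈ R, ¬ Q.1 ∣ l).filter fun l => P.1 ∣ l).card := by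
    rw [Cn, ← Finset.card_filter_add_card_filter_not (fun l => P.1 ∣ l), add_comm]
    congr 1
    rw [Cn, Finset.filter_filter]
    congr 1
    refine Finset.filter_congr fun l _ => ?_
    rw [Finset.forall_mem_insert, and_comm]
  rw [h0]
  congr 1
  split_ifs with hj
  · symm
    rw [Cn]
    refine Finset.card_bij (fun l _ => P.1 * l) ?_
      (fun a _ b _ h => mul_left_cancel₀ P.2.2.ne_zero h) ?_
    · intro l hl
      rw [Finset.mem_filter, mem_Mon] at hl
      rw [Finset.mem_filter, Finset.mem_filter, mem_Mon]
      refine ⟨⟨⟨P.2.1.mul hl.1.1, ?_⟩, ?_⟩, Dvd.intro _ rfl⟩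
      · rw [P.2.1.natDegree_mul hl.1.1, hl.1.2]; omega
      · intro Q hQ hd
        rcases Q.2.2.prime.dvd_or_dvd hd with h | h
        · have hne : Q ≠ P := by rintro rfl; exact hP hQ
          exact Q.2.2.coprime_iff_not_dvd.mp (pr_coprime hne) h
        · exact hl.2 Q hQ h
    · intro b hb
      rw [Finset.mem_filter, Finset.mem_filter, mem_Mon] at hb
      obtain ⟨⟨⟨h1, h2⟩, h3⟩, l, rfl⟩ := hb
      have hl : l.Monic := P.2.1.of_mul_monic_left h1
      refine ⟨l, ?_, rfl⟩
      rw [Finset.mem_filter, mem_Mon]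
      refine ⟨⟨hl, ?_⟩, fun Q hQ hd => h3 Q hQ (hd.mul_left _)⟩
      rw [P.2.1.natDegree_mul hl] at h2
      omega
  · rw [Finset.card_eq_zero, Finset.filter_eq_empty_iff]
    intro l hl hd
    rw [Finset.mem_filter, mem_Mon] at hl
    have := natDegree_le_of_dvd hd hl.1.1.ne_zero
    omega

variable (Fq) in
/-- real zeta value -/
def zet : ℝ := (1 - (qq Fq)⁻¹)⁻¹

lemma zet_pos : 0 < zet Fq := by
  have h5 : (qq Fq)⁻¹ < 1 := inv_lt_one_of_one_lt₀ one_lt_qq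
  rw [zet]; exact inv_pos.mpr (by linarith)

lemma hasSum_geom : HasSum (fun j : ℕ => ((qq Fq)⁻¹) ^ j) (zet Fq) :=
  hasSum_geometric_of_lt_one (inv_nonneg.mpr qq_pos.le) (inv_lt_one_of_one_lt₀ one_lt_qq)

lemma hasSum_Cn (R : Finset (Pr Fq)) :
    HasSum (fun j : ℕ => (Cn R j : ℝ) / qq Fq ^ (2 * j)) (zet Fq * ww R) := by
  classical
  induction R using Finset.induction_on with
  | empty =>
    have h1 : ∀ j : ℕ, (Cn (∅ : Finset (Pr Fq)) j : ℝ) / qq Fq ^ (2 * j) = ((qq Fq)⁻¹) ^ j := by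
      intro j
      have : Cn (∅ : Finset (Pr Fq)) j = Fintype.card Fq ^ j := by
        rw [← card_Mon, Cn]; simp
      rw [this]
      push_cast
      have := qq_pos (Fq := Fq)
      rw [inv_pow, two_mul, pow_add]
      field_simp
    simp only [h1, ww, Finset.prod_empty, mul_one]
    exact hasSum_geom
  | insert P R hP ih =>
    have hq := qq_pos (Fq := Fq)
    have h2 : HasSum (fun j : ℕ => ((if P.1.natDegree ≤ j then Cn R (j - P.1.natDegree) else 0 : ℕ) : ℝ)
        / qq Fq ^ (2 * j)) (1 / nm P ^ 2 * (zet Fq * ww R)) := by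
      rw [← (add_left_injective P.1.natDegree).hasSum_iff]
      · refine (ih.mul_left (1 / nm P ^ 2)).congr_fun ?_
        intro j
        simp only [Function.comp_apply]
        rw [if_pos (by omega), Nat.add_sub_cancel, nm, ← pow_mul, mul_add, pow_add,
          mul_comm P.1.natDegree 2]
        field_simp
      · intro j hj
        rw [if_neg]
        · simp
        · intro h
          exact hj ⟨j - P.1.natDegree, by simp only; omega⟩
    have h3 := ih.sub h2
    have h4 : zet Fq * ww (insert P R) = zet Fq * ww R - 1 / nm P ^ 2 * (zet Fq * ww R) := by
      rw [ww, ww, Finset.prod_insert hP]; ring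
    rw [h4]
    refine h3.congr_fun fun j => ?_
    rw [Cn_insert hP j]
    push_cast
    ring

lemma Cn_le (R : Finset (Pr Fq)) (j : ℕ) : (Cn R j : ℝ) / qq Fq ^ (2 * j) ≤ ((qq Fq)⁻¹) ^ j := by
  classical
  have h1 : Cn R j ≤ Fintype.card Fq ^ j := by
    rw [← card_Mon]; exact Finset.card_filter_le _ _
  have h2 : (Cn R j : ℝ) ≤ qq Fq ^ j := by exact_mod_cast h1
  have := qq_pos (Fq := Fq)
  calc _ ≤ qq Fq ^ j / qq Fq ^ (2 * j) := by gcongr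
    _ = _ := by rw [inv_pow, two_mul, pow_add]; field_simp

/-- main part -/
def mp (R : Finset (Pr Fq)) (n : ℕ) : ℝ := ∑ j ∈ Finset.range n, (Cn R j : ℝ) / qq Fq ^ (2 * j)

lemma mp_bound (R : Finset (Pr Fq)) (n : ℕ) :
    |mp R n - zet Fq * ww R| ≤ zet Fq * ((qq Fq)⁻¹) ^ n := by
  have hq := qq_pos (Fq := Fq)
  have h1 : mp R n ≤ zet Fq * ww R :=
    sum_le_hasSum _ (fun j _ => by positivity) (hasSum_Cn R)
  have h2 := sum_le_hasSum (Finset.range n) (fun j _ => sub_nonneg.mpr (Cn_le R j))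
    ((hasSum_geom (Fq := Fq)).sub (hasSum_Cn R))
  rw [Finset.sum_sub_distrib] at h2
  have h3 : ∑ j ∈ Finset.range n, ((qq Fq)⁻¹) ^ j = zet Fq * (1 - ((qq Fq)⁻¹) ^ n) := by
    have h5 : (qq Fq)⁻¹ < 1 := inv_lt_one_of_one_lt₀ one_lt_qq
    rw [geom_sum_eq h5.ne, zet]
    have h6 : (qq Fq)⁻¹ - 1 ≠ 0 := by linarith
    have h7 : 1 - (qq Fq)⁻¹ ≠ 0 := by linarith
    rw [inv_mul_eq_div, div_eq_div_iff h6 h7]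
    ring
  rw [h3] at h2
  rw [abs_le]
  change _ - mp R n ≤ _ at h2
  constructor
  · linarith
  · have : 0 ≤ zet Fq * ((qq Fq)⁻¹) ^ n := by
      have := zet_pos (Fq := Fq)
      positivity
    linarith
end euler
end EvenChar

namespace EvenChar
section family
set_option linter.unusedSectionVars false

variable {Fq : Type} [Field Fq] [Fintype Fq]

/-- real `L`-value at 1 -/
def Lr (N : ℕ) (u : RatFunc Fq) : ℝ :=
  ∑ d ∈ Finset.range (N + 1), (∑ f ∈ Mon Fq d, (quadSym u f : ℝ)) / qq Fq ^ d

lemma Acoeff_eq (u : RatFunc Fq) (n : ℕ) :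
    Acoeff u n = ((∑ f ∈ Mon Fq n, (quadSym u f : ℝ) : ℝ) : ℂ) := by
  have h : ∀ f : Fq[X], f ∈ Mon Fq n ↔ f.Monic ∧ f.natDegree = n := fun f => mem_Mon
  rw [Acoeff]
  have h1 := (Equiv.subtypeEquivRight h).tsum_eq
    (fun f : {f : Polynomial Fq // f.Monic ∧ f.natDegree = n} => (quadSym u f.1 : ℂ))
  rw [← h1]
  have h2 := Finset.tsum_subtype (Mon Fq n) (fun f => (quadSym u f : ℂ))
  push_cast
  rw [← h2]
  rfl

lemma Lfun_eq (N : ℕ) (u : RatFunc Fq) : Lfun N u 1 = ((Lr N u : ℝ) : ℂ) := by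
  rw [Lfun, Lr]
  push_cast
  refine Finset.sum_congr rfl fun n _ => ?_
  rw [Acoeff_eq, one_mul, Complex.cpow_neg, Complex.cpow_natCast, div_eq_mul_inv]
  push_cast
  rfl

open scoped Classical in
lemma quadSym_sq {l : Fq[X]} (hl : l.Monic) (u : RatFunc Fq) :
    quadSym u (l ^ 2) = if IsCoprime l u.denom then 1 else 0 := by
  rw [quadSym]
  have h1 : IsCoprime (l ^ 2) u.denom ↔ IsCoprime l u.denom := IsCoprime.pow_left_iff (by norm_num)
  simp only [h1]
  split_ifs with h
  · rw [normalizedFactors_pow, Multiset.map_nsmul, Multiset.prod_nsmul, ← Multiset.prod_map_pow]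
    refine Multiset.prod_eq_one ?_
    intro z hz
    obtain ⟨P, _, rfl⟩ := Multiset.mem_map.mp hz
    split_ifs <;> norm_num
  · rfl

open scoped Classical in
/-- contribution of the squares -/
def Sq (u : RatFunc Fq) (d : ℕ) : ℝ :=
  ∑ f ∈ (Mon Fq d).filter (fun f => derivative f = 0), (quadSym u f : ℝ)

lemma deriv_sq [CharP Fq 2] (l : Fq[X]) : derivative (l ^ 2) = 0 := by
  rw [derivative_pow]
  have : (C ((2 : ℕ) : Fq)) = (0 : Fq[X]) := by
    rw [CharP.cast_eq_zero, C_0]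
  rw [this]; simp

lemma Sq_odd [CharP Fq 2] (u : RatFunc Fq) (j : ℕ) : Sq u (2 * j + 1) = 0 := by
  classical
  rw [Sq]
  refine Finset.sum_eq_zero fun f hf => ?_
  exfalso
  rw [Finset.mem_filter, mem_Mon] at hf
  obtain ⟨l, hl, rfl⟩ := sq_of_derivative_zero hf.1.1 hf.2
  have := hf.1.2
  rw [natDegree_pow] at this
  omega

lemma Sq_even [CharP Fq 2] {c : Co Fq} (hg : Good c) (G : Fq[X]) (j : ℕ) :
    Sq (Ph c + algebraMap Fq[X] (RatFunc Fq) G) (2 * j) = Cn (ex c).support j := by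
  classical
  rw [Sq, Cn, Finset.card_filter, Nat.cast_sum]
  symm
  refine Finset.sum_bij (fun l _ => l ^ 2) ?_ ?_ ?_ ?_
  · intro l hl
    rw [mem_Mon] at hl
    rw [Finset.mem_filter, mem_Mon]
    refine ⟨⟨hl.1.pow 2, ?_⟩, deriv_sq l⟩
    rw [natDegree_pow, hl.2]
  · intro a ha b hb h
    have h2 : (a - b) ^ 2 = 0 := by rw [sub_pow_char, h, sub_self]
    exact sub_eq_zero.mp (pow_eq_zero_iff (by norm_num) |>.mp h2)
  · intro f hf
    rw [Finset.mem_filter, mem_Mon] at hf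
    obtain ⟨l, hl, rfl⟩ := sq_of_derivative_zero hf.1.1 hf.2
    refine ⟨l, mem_Mon.mpr ⟨hl, ?_⟩, rfl⟩
    have := hf.1.2
    rw [natDegree_pow] at this
    omega
  · intro l hl
    rw [mem_Mon] at hl
    beta_reduce
    rw [quadSym_sq hl.1, coprime_Ph_iff hg]
    split_ifs <;> simp

lemma sum_even (A : ℕ → ℝ) (hA : ∀ j, A (2 * j + 1) = 0) (g : ℕ) :
    ∑ d ∈ Finset.range (2 * g + 1), A d = ∑ j ∈ Finset.range (g + 1), A (2 * j) := by
  induction g with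
  | zero => simp
  | succ g ih =>
    rw [Finset.sum_range_succ _ (g + 1), ← ih, show 2 * (g + 1) + 1 = (2 * g + 1) + 1 + 1 by ring,
      Finset.sum_range_succ, Finset.sum_range_succ, hA]
    rw [show 2 * (g + 1) = 2 * g + 1 + 1 by ring]; ring

lemma sum_even' (A : ℕ → ℝ) (hA : ∀ j, A (2 * j + 1) = 0) {g N : ℕ}
    (hN : N = 2 * g ∨ N = 2 * g + 1) :
    ∑ d ∈ Finset.range (N + 1), A d = ∑ j ∈ Finset.range (g + 1), A (2 * j) := by
  rcases hN with rfl | rfl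
  · exact sum_even A hA g
  · rw [Finset.sum_range_succ, hA, add_zero]; exact sum_even A hA g

/-- contribution of the nonsquares -/
def Er (N : ℕ) (u : RatFunc Fq) : ℝ :=
  open scoped Classical in
  ∑ d ∈ Finset.range (N + 1),
    (∑ f ∈ (Mon Fq d).filter (fun f => ¬ derivative f = 0), (quadSym u f : ℝ)) / qq Fq ^ d

lemma Lr_eq [CharP Fq 2] {c : Co Fq} (hg : Good c) (G : Fq[X]) {g N : ℕ}
    (hN : N = 2 * g ∨ N = 2 * g + 1) :
    Lr N (Ph c + algebraMap Fq[X] (RatFunc Fq) G) = mp (ex c).support (g + 1) +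
      Er N (Ph c + algebraMap Fq[X] (RatFunc Fq) G) := by
  classical
  set u := Ph c + algebraMap Fq[X] (RatFunc Fq) G with hu
  have h1 : mp (ex c).support (g + 1) = ∑ d ∈ Finset.range (N + 1), Sq u d / qq Fq ^ d := by
    rw [sum_even' (fun d => Sq u d / qq Fq ^ d) (fun j => by rw [Sq_odd, zero_div]) hN, mp]
    refine Finset.sum_congr rfl fun j _ => ?_
    rw [hu, Sq_even hg]
  rw [h1, Lr, Er, ← Finset.sum_add_distrib]
  refine Finset.sum_congr rfl fun d _ => ?_
  rw [← add_div, Sq, Finset.sum_filter_add_sum_filter_not]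

lemma quadSym_split [CharP Fq 2] {f : Fq[X]} (hm : f.Monic) {c : Co Fq} (G : Fq[X]) :
    quadSym (Ph c + algebraMap Fq[X] (RatFunc Fq) G) f =
      quadSym (Ph c) f * quadSym (algebraMap Fq[X] (RatFunc Fq) G) f := by
  by_cases h : IsCoprime f (Ph c).denom
  · exact quadSym_add hm h coprime_denom_poly
  · rw [quadSym_not h, zero_mul]
    refine quadSym_not fun h' => h ?_
    rwa [coprime_denom_sum_iff coprime_denom_poly] at h'

lemma Er_bound [CharP Fq 2] (G : Fq[X]) {N g : ℕ} (hN : N = 2 * g ∨ N = 2 * g + 1) (r : ℕ) :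
    |∑ c ∈ CC Fq r, Er N (Ph c + algebraMap Fq[X] (RatFunc Fq) G)| ≤
      (2 * g + 2) * (2 * 2 ^ g * qq Fq ^ r) := by
  classical
  have hq := qq_pos (Fq := Fq)
  simp only [Er]
  rw [Finset.sum_comm]
  refine (Finset.abs_sum_le_sum_abs _ _).trans ?_
  have h1 : ∀ d ∈ Finset.range (N + 1), |∑ c ∈ CC Fq r,
      (∑ f ∈ (Mon Fq d).filter (fun f => ¬ derivative f = 0),
        (quadSym (Ph c + algebraMap Fq[X] (RatFunc Fq) G) f : ℝ)) / qq Fq ^ d| ≤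
      2 * 2 ^ g * qq Fq ^ r := by
    intro d hd
    rw [Finset.mem_range] at hd
    rw [← Finset.sum_div, abs_div, abs_of_pos (pow_pos hq d), div_le_iff₀ (pow_pos hq d),
      Finset.sum_comm]
    refine (Finset.abs_sum_le_sum_abs _ _).trans ?_
    have h2 : ∀ f ∈ (Mon Fq d).filter (fun f => ¬ derivative f = 0),
        |∑ c ∈ CC Fq r, (quadSym (Ph c + algebraMap Fq[X] (RatFunc Fq) G) f : ℝ)| ≤
        2 * 2 ^ g * qq Fq ^ r := by
      intro f hf
      rw [Finset.mem_filter, mem_Mon] at hf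
      obtain ⟨⟨hm, hdeg⟩, hne⟩ := hf
      have h3 : (derivative f).natDegree ≤ 2 * g := by
        have := natDegree_derivative_le f
        omega
      have h4 := CC_bound hm hne h3 r
      have h5 := abs_quadSym_le hm (algebraMap Fq[X] (RatFunc Fq) G)
      simp only [quadSym_split hm]
      push_cast
      rw [← Finset.sum_mul, abs_mul]
      have h4' : |∑ c ∈ CC Fq r, (quadSym (Ph c) f : ℝ)| ≤ 2 * 2 ^ g * qq Fq ^ r := by
        exact_mod_cast h4
      have h5' : |(quadSym (algebraMap Fq[X] (RatFunc Fq) G) f : ℝ)| ≤ 1 := by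
        exact_mod_cast h5
      calc _ ≤ (2 * 2 ^ g * qq Fq ^ r) * 1 := by gcongr
        _ = _ := mul_one _
    refine (Finset.sum_le_sum h2).trans ?_
    rw [Finset.sum_const, nsmul_eq_mul, mul_comm]
    have h6 : (((Mon Fq d).filter (fun f => ¬ derivative f = 0)).card : ℝ) ≤ qq Fq ^ d := by
      have := Finset.card_filter_le (Mon Fq d) (fun f => ¬ derivative f = 0)
      rw [card_Mon] at this
      exact_mod_cast this
    gcongr
  refine (Finset.sum_le_sum h1).trans ?_
  rw [Finset.sum_const, nsmul_eq_mul, Finset.card_range]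
  have h7 : ((N + 1 : ℕ) : ℝ) ≤ 2 * g + 2 := by
    have : N + 1 ≤ 2 * g + 2 := by omega
    exact_mod_cast this
  gcongr

/-- total over the family -/
def Tot (Γ : ℕ → Finset Fq[X]) (N n : ℕ) : ℝ :=
  ∑ x ∈ Finset.HasAntidiagonal.antidiagonal n, ∑ G ∈ Γ x.2, ∑ c ∈ CC Fq x.1,
    Lr N (Ph c + algebraMap Fq[X] (RatFunc Fq) G)

/-- size of the family -/
def Siz (Γ : ℕ → Finset Fq[X]) (n : ℕ) : ℝ :=
  ∑ x ∈ Finset.HasAntidiagonal.antidiagonal n, ((Γ x.2).card : ℝ) * ((CC Fq x.1).card : ℝ)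

/-- main term of the family -/
def Mai (Γ : ℕ → Finset Fq[X]) (n : ℕ) : ℝ :=
  ∑ x ∈ Finset.HasAntidiagonal.antidiagonal n, ((Γ x.2).card : ℝ) * (∑ c ∈ CC Fq x.1, ww (ex c).support)

lemma Tot_bound [CharP Fq 2] {Γ : ℕ → Finset Fq[X]}
    (hΓ : ∀ s, ((Γ s).card : ℝ) ≤ 2 * qq Fq ^ s) {N g : ℕ} (hN : N = 2 * g ∨ N = 2 * g + 1) :
    |Tot Γ N (g + 1) - zet Fq * Mai Γ (g + 1)| ≤
      Siz Γ (g + 1) * (zet Fq * ((qq Fq)⁻¹) ^ (g + 1)) +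
      (g + 2) * ((2 * g + 2) * (2 * 2 ^ g)) * (2 * qq Fq ^ (g + 1)) := by
  classical
  have hq := qq_pos (Fq := Fq)
  have h1 : ∀ x ∈ Finset.HasAntidiagonal.antidiagonal (g + 1), |(∑ G ∈ Γ x.2, ∑ c ∈ CC Fq x.1,
      Lr N (Ph c + algebraMap Fq[X] (RatFunc Fq) G)) -
      zet Fq * (((Γ x.2).card : ℝ) * (∑ c ∈ CC Fq x.1, ww (ex c).support))| ≤
      ((Γ x.2).card : ℝ) * ((CC Fq x.1).card : ℝ) * (zet Fq * ((qq Fq)⁻¹) ^ (g + 1)) +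
      ((2 * g + 2) * (2 * 2 ^ g)) * (2 * qq Fq ^ (g + 1)) := by
    intro x hx
    rw [Finset.HasAntidiagonal.mem_antidiagonal] at hx
    have h2 : zet Fq * (((Γ x.2).card : ℝ) * (∑ c ∈ CC Fq x.1, ww (ex c).support)) =
        ∑ G ∈ Γ x.2, ∑ c ∈ CC Fq x.1, zet Fq * ww (ex c).support := by
      rw [Finset.sum_const, nsmul_eq_mul, ← Finset.mul_sum]; ring
    rw [h2, ← Finset.sum_sub_distrib]
    refine (Finset.abs_sum_le_sum_abs _ _).trans ?_
    have h3 : ∀ G ∈ Γ x.2, |∑ c ∈ CC Fq x.1, Lr N (Ph c + algebraMap Fq[X] (RatFunc Fq) G) -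
        ∑ c ∈ CC Fq x.1, zet Fq * ww (ex c).support| ≤
        ((CC Fq x.1).card : ℝ) * (zet Fq * ((qq Fq)⁻¹) ^ (g + 1)) +
        (2 * g + 2) * (2 * 2 ^ g * qq Fq ^ x.1) := by
      intro G _
      have h4 : ∑ c ∈ CC Fq x.1, Lr N (Ph c + algebraMap Fq[X] (RatFunc Fq) G) -
          ∑ c ∈ CC Fq x.1, zet Fq * ww (ex c).support =
          ∑ c ∈ CC Fq x.1, (mp (ex c).support (g + 1) - zet Fq * ww (ex c).support) +
          ∑ c ∈ CC Fq x.1, Er N (Ph c + algebraMap Fq[X] (RatFunc Fq) G) := by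
        rw [← Finset.sum_sub_distrib, ← Finset.sum_add_distrib]
        refine Finset.sum_congr rfl fun c hc => ?_
        rw [Lr_eq (mem_CC.mp hc).1 G hN]; ring
      rw [h4]
      refine (abs_add_le _ _).trans (add_le_add ?_ (Er_bound G hN _))
      refine (Finset.abs_sum_le_sum_abs _ _).trans ?_
      refine (Finset.sum_le_sum fun c _ => mp_bound _ _).trans ?_
      rw [Finset.sum_const, nsmul_eq_mul]
    refine (Finset.sum_le_sum h3).trans ?_
    rw [Finset.sum_const, nsmul_eq_mul, mul_add, ← mul_assoc]
    refine add_le_add le_rfl ?_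
    calc ((Γ x.2).card : ℝ) * ((2 * g + 2) * (2 * 2 ^ g * qq Fq ^ x.1))
        ≤ (2 * qq Fq ^ x.2) * ((2 * g + 2) * (2 * 2 ^ g * qq Fq ^ x.1)) := by
          gcongr
          exact hΓ x.2
      _ = _ := by rw [← hx, pow_add]; ring
  rw [Tot, Mai, Finset.mul_sum, ← Finset.sum_sub_distrib]
  refine (Finset.abs_sum_le_sum_abs _ _).trans ((Finset.sum_le_sum h1).trans ?_)
  rw [Finset.sum_add_distrib, ← Finset.sum_mul, Finset.sum_const, nsmul_eq_mul,
    Finset.Nat.card_antidiagonal, Siz]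
  push_cast
  rw [show (g : ℝ) + 1 + 1 = g + 2 by ring, mul_assoc]
  exact le_of_eq (by ring)

/-- Convolution of a convergent sequence with a summable one. -/
lemma tendsto_conv {x γ : ℕ → ℝ} {l : ℝ} (hx : Filter.Tendsto x Filter.atTop (nhds l))
    (hγ : Summable fun s => ‖γ s‖) :
    Filter.Tendsto (fun n => ∑ p ∈ Finset.HasAntidiagonal.antidiagonal n, γ p.2 * x p.1) Filter.atTop
      (nhds ((∑' s, γ s) * l)) := by
  obtain ⟨K, hK⟩ := (Metric.isBounded_range_of_tendsto x hx).exists_norm_le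
  have hK' : ∀ n, ‖x n‖ ≤ K := fun n => hK _ ⟨n, rfl⟩
  have h1 : ∀ n, ∑ p ∈ Finset.HasAntidiagonal.antidiagonal n, γ p.2 * x p.1 =
      ∑' s, if s ≤ n then γ s * x (n - s) else 0 := by
    intro n
    rw [tsum_eq_sum (s := Finset.range (n + 1))]
    · rw [← Finset.Nat.sum_antidiagonal_swap, Finset.Nat.sum_antidiagonal_eq_sum_range_succ_mk]
      refine Finset.sum_congr rfl fun s hs => ?_
      rw [Finset.mem_range] at hs
      rw [if_pos (by omega)]
      rfl
    · intro s hs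
      rw [Finset.mem_range] at hs
      rw [if_neg (by omega)]
  simp only [h1]
  rw [← tsum_mul_right]
  refine tendsto_tsum_of_dominated_convergence (bound := fun s => ‖γ s‖ * K) (hγ.mul_right K) ?_ ?_
  · intro s
    have h2 : Filter.Tendsto (fun n => γ s * x (n - s)) Filter.atTop (nhds (γ s * l)) :=
      (hx.comp (Filter.tendsto_sub_atTop_nat s)).const_mul _
    refine h2.congr' ?_
    filter_upwards [Filter.eventually_ge_atTop s] with n hn
    rw [if_pos hn]
  · refine Filter.Eventually.of_forall fun n s => ?_
    split_ifs
    · rw [norm_mul]; gcongr; exact hK' _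
    · rw [norm_zero]
      have := (norm_nonneg (x 0)).trans (hK' 0)
      positivity

lemma conv_norm (Γ : ℕ → Finset Fq[X]) (F : ℕ → ℝ) (n : ℕ) :
    (∑ x ∈ Finset.HasAntidiagonal.antidiagonal n, ((Γ x.2).card : ℝ) * F x.1) / qq Fq ^ (2 * n) =
    ∑ x ∈ Finset.HasAntidiagonal.antidiagonal n, (((Γ x.2).card : ℝ) / qq Fq ^ (2 * x.2)) *
      (F x.1 / qq Fq ^ (2 * x.1)) := by
  rw [Finset.sum_div]
  refine Finset.sum_congr rfl fun x hx => ?_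
  rw [Finset.HasAntidiagonal.mem_antidiagonal] at hx
  rw [div_mul_div_comm, ← pow_add]
  congr 2
  omega

theorem family_limit [CharP Fq 2] (hq2 : 2 < Fintype.card Fq) {Γ : ℕ → Finset Fq[X]}
    (hΓ : ∀ s, ((Γ s).card : ℝ) ≤ 2 * qq Fq ^ s) (hne : ∃ s, (Γ s).Nonempty) {N : ℕ → ℕ}
    (hN : ∀ g, N g = 2 * g ∨ N g = 2 * g + 1) :
    Filter.Tendsto (fun g => (Tot Γ (N g) (g + 1) / Siz Γ (g + 1)) / (zet Fq * limP Fq))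
      Filter.atTop (nhds 1) := by
  classical
  have hq := qq_pos (Fq := Fq)
  have hz := zet_pos (Fq := Fq)
  have hg1 := (hasSum_geom (Fq := Fq)).summable
  have hγ : Summable fun s => ‖((Γ s).card : ℝ) / qq Fq ^ (2 * s)‖ := by
    refine Summable.of_nonneg_of_le (fun _ => norm_nonneg _) (fun s => ?_) (hg1.mul_left 2)
    rw [Real.norm_of_nonneg (by positivity), two_mul s, pow_add, div_le_iff₀ (by positivity)]
    refine (hΓ s).trans (le_of_eq ?_)
    rw [inv_pow]; field_simp
  set σ := ∑' s, ((Γ s).card : ℝ) / qq Fq ^ (2 * s) with hσ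
  have hσ0 : 0 < σ := by
    obtain ⟨s, hs⟩ := hne
    refine hγ.of_norm.tsum_pos (fun _ => by positivity) s ?_
    have : 0 < (Γ s).card := Finset.card_pos.mpr hs
    positivity
  have hS := tendsto_conv (card_tendsto (Fq := Fq)) hγ
  have hM := tendsto_conv (wsum_tendsto (Fq := Fq)) hγ
  simp only [← conv_norm Γ (fun n => ((CC Fq n).card : ℝ))] at hS
  simp only [← conv_norm Γ (fun n => ∑ c ∈ CC Fq n, ww (ex c).support)] at hM
  replace hS := hS.comp (Filter.tendsto_add_atTop_nat 1)
  replace hM := hM.comp (Filter.tendsto_add_atTop_nat 1)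
  change Filter.Tendsto (fun g => Siz Γ (g + 1) / qq Fq ^ (2 * (g + 1))) _ _ at hS
  change Filter.Tendsto (fun g => Mai Γ (g + 1) / qq Fq ^ (2 * (g + 1))) _ _ at hM
  have hgeo : Filter.Tendsto (fun g : ℕ => ((qq Fq)⁻¹) ^ (g + 1)) Filter.atTop (nhds 0) :=
    (tendsto_pow_atTop_nhds_zero_of_lt_one (inv_nonneg.mpr hq.le)
      (inv_lt_one_of_one_lt₀ one_lt_qq)).comp (Filter.tendsto_add_atTop_nat 1)
  have herr : Filter.Tendsto (fun g : ℕ => ((g : ℝ) + 2) * ((2 * g + 2) * (2 * 2 ^ g)) *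
      (2 * qq Fq ^ (g + 1)) / qq Fq ^ (2 * (g + 1))) Filter.atTop (nhds 0) := by
    have hr : |2 / qq Fq| < 1 := by
      rw [abs_of_pos (by positivity), div_lt_one hq]
      exact_mod_cast hq2
    have t2 := tendsto_pow_const_mul_const_pow_of_abs_lt_one 2 hr
    have t1 := tendsto_pow_const_mul_const_pow_of_abs_lt_one 1 hr
    have t0 := tendsto_pow_const_mul_const_pow_of_abs_lt_one 0 hr
    have t := ((t2.const_mul (8 / qq Fq)).add (t1.const_mul (24 / qq Fq))).add
      (t0.const_mul (16 / qq Fq))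
    simp only [mul_zero, add_zero] at t
    refine t.congr fun g => ?_
    rw [div_pow, two_mul (g + 1), pow_add _ (g + 1), pow_succ (qq Fq) g]
    field_simp
    ring
  have hdiff : Filter.Tendsto (fun g => Tot Γ (N g) (g + 1) / qq Fq ^ (2 * (g + 1)) -
      zet Fq * (Mai Γ (g + 1) / qq Fq ^ (2 * (g + 1)))) Filter.atTop (nhds 0) := by
    have hb := (hS.mul (hgeo.const_mul (zet Fq))).add herr
    simp only [mul_zero, add_zero] at hb
    refine squeeze_zero_norm (fun g => ?_) hb
    have h1 := Tot_bound hΓ (hN g)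
    rw [← mul_div_assoc, ← sub_div, Real.norm_eq_abs, abs_div, abs_of_pos (pow_pos hq _),
      div_mul_eq_mul_div, ← add_div]
    gcongr
  have hT := hdiff.add (hM.const_mul (zet Fq))
  simp only [sub_add_cancel, zero_add] at hT
  have hC := limC_ne (Fq := Fq)
  have hP := limP_ne (Fq := Fq)
  have hfin := (hT.div hS (mul_ne_zero hσ0.ne' hC)).div_const (zet Fq * limP Fq)
  have h1 : zet Fq * (σ * (limC Fq * limP Fq)) / (σ * limC Fq) / (zet Fq * limP Fq) = 1 := by
    have := hσ0.ne'
    have := hz.ne'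
    field_simp
  rw [h1] at hfin
  refine hfin.congr fun g => ?_
  simp only [Pi.div_apply]
  rw [div_div_div_cancel_right₀ (pow_pos hq _).ne']
end family
end EvenChar

namespace EvenChar
section final

variable {Fq : Type} [Field Fq] [Fintype Fq]

/-- index set of a family -/
def Ind (Γ : ℕ → Finset Fq[X]) (n : ℕ) : Finset (Sigma fun _ : ℕ × ℕ => Fq[X] × Co Fq) :=
  (Finset.HasAntidiagonal.antidiagonal n).sigma fun x => Γ x.2 ×ˢ CC Fq x.1

/-- the element with a given index -/
def Elt (y : Sigma fun _ : ℕ × ℕ => Fq[X] × Co Fq) : RatFunc Fq :=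
  Ph y.2.2 + algebraMap Fq[X] (RatFunc Fq) y.2.1

lemma mem_Ind {Γ : ℕ → Finset Fq[X]} {n : ℕ} {y : Sigma fun _ : ℕ × ℕ => Fq[X] × Co Fq} :
    y ∈ Ind Γ n ↔ y.1.1 + y.1.2 = n ∧ y.2.1 ∈ Γ y.1.2 ∧ y.2.2 ∈ CC Fq y.1.1 := by
  rw [Ind, Finset.mem_sigma, Finset.HasAntidiagonal.mem_antidiagonal, Finset.mem_product]

lemma Elt_inj (Γ : ℕ → Finset Fq[X]) (n : ℕ) : Set.InjOn (Elt (Fq := Fq)) (↑(Ind Γ n)) := by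
  rintro ⟨⟨r, s⟩, G, c⟩ hy ⟨⟨r', s'⟩, G', c'⟩ hy' h
  rw [Finset.mem_coe, mem_Ind] at hy hy'
  obtain ⟨h1, h2, h3⟩ := hy
  obtain ⟨h1', h2', h3'⟩ := hy'
  rw [mem_CC] at h3 h3'
  obtain ⟨rfl, rfl⟩ := Ph_inj h3.1 h3'.1 h
  have hr : r = r' := h3.2.symm.trans h3'.2
  have hs : s = s' := by simp only at h1 h1'; omega
  subst hr; subst hs; rfl

lemma fam_sum {Γ : ℕ → Finset Fq[X]} {n : ℕ} {S : Set (RatFunc Fq)}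
    (hS : S = Elt '' (Ind Γ n : Set _)) (N : ℕ) :
    (∑' u : S, Lfun N u.1 1) = ((Tot Γ N n : ℝ) : ℂ) ∧ (Nat.card S : ℂ) = ((Siz Γ n : ℝ) : ℂ) := by
  classical
  have hS' : S = ((Ind Γ n).image Elt : Finset (RatFunc Fq)) := by rw [hS, Finset.coe_image]
  subst hS'
  constructor
  · rw [Finset.tsum_subtype' ((Ind Γ n).image Elt) (fun u => Lfun N u 1),
      Finset.sum_image (Elt_inj Γ n), Ind, Finset.sum_sigma, Tot]
    push_cast
    refine Finset.sum_congr rfl fun x _ => ?_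
    rw [Finset.sum_product]
    refine Finset.sum_congr rfl fun G _ => Finset.sum_congr rfl fun c _ => ?_
    rw [Lfun_eq]; rfl
  · rw [Nat.card_coe_set_eq, Set.ncard_coe_finset, Finset.card_image_of_injOn (Elt_inj Γ n),
      Ind, Finset.card_sigma, Siz]
    push_cast
    refine Finset.sum_congr rfl fun x _ => ?_
    rw [Finset.card_product]; push_cast; rfl

lemma zetaC_eq : zetaC (Fintype.card Fq) 2 = ((zet Fq : ℝ) : ℂ) := by
  rw [zetaC, zet, show (1 : ℂ) - 2 = -1 by norm_num, Complex.cpow_neg_one]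
  push_cast; rfl

lemma eulerP_eq : eulerP Fq 2 = ((limP Fq : ℝ) : ℂ) := by
  have hm : Multipliable fun P : Pr Fq => (1 - 1 / (nm P ^ 2 * (nm P + 1))) := by
    have := multipliable_one_add_of_summable (f := fun P : Pr Fq => -(1 / (nm P ^ 2 * (nm P + 1))))
      summable_P
    simpa only [← sub_eq_add_neg] using this
  have h := hm.hasProd.map Complex.ofRealHom Complex.continuous_ofReal
  have h2 := h.tprod_eq
  rw [eulerP, limP]
  refine Eq.trans ?_ h2
  refine tprod_congr fun P => ?_
  simp only [Function.comp, Complex.ofRealHom_eq_coe, nm]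
  push_cast
  rw [Complex.cpow_natCast, one_div]
  norm_cast

lemma fam_limit [CharP Fq 2] (hq2 : 2 < Fintype.card Fq) {Γ : ℕ → Finset Fq[X]}
    (hΓ : ∀ s, ((Γ s).card : ℝ) ≤ 2 * qq Fq ^ s) (hne : ∃ s, (Γ s).Nonempty) {N : ℕ → ℕ}
    (hN : ∀ g, N g = 2 * g ∨ N g = 2 * g + 1) {S : ℕ → Set (RatFunc Fq)}
    (hS : ∀ n, S n = Elt '' (Ind Γ n : Set _)) :
    Filter.Tendsto
      (fun g : ℕ => ((∑' u : (S (g + 1) : Set (RatFunc Fq)), Lfun (N g) u.1 1) /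
            (Nat.card (S (g + 1) : Set (RatFunc Fq)) : ℂ)) /
          (zetaC (Fintype.card Fq) 2 * eulerP Fq 2))
      Filter.atTop (nhds 1) := by
  have h := family_limit hq2 hΓ hne hN
  have h2 := (Complex.continuous_ofReal.tendsto 1).comp h
  rw [Complex.ofReal_one] at h2
  refine h2.congr fun g => ?_
  rw [(fam_sum (hS (g + 1)) (N g)).1, (fam_sum (hS (g + 1)) (N g)).2, zetaC_eq, eulerP_eq]
  simp only [Function.comp]
  push_cast; rfl

/-- the family concentrated in degree zero -/
def Gz (ξ : Fq) (s : ℕ) : Finset Fq[X] := if s = 0 then {C ξ} else ∅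

lemma Gz_bound (ξ : Fq) (s : ℕ) : ((Gz ξ s).card : ℝ) ≤ 2 * qq Fq ^ s := by
  have := one_le_pow₀ (one_lt_qq (Fq := Fq)).le (n := s)
  have h : (Gz ξ s).card ≤ 1 := by rw [Gz]; split_ifs <;> simp
  have h' : ((Gz ξ s).card : ℝ) ≤ 1 := by exact_mod_cast h
  linarith

lemma F'_eq (ξ : Fq) (n : ℕ) : F'fam ξ n = Elt '' (Ind (Gz ξ) n : Set _) := by
  rw [F'fam, Ffam_eq]
  ext u
  constructor
  · rintro ⟨_, ⟨c, hc, rfl⟩, rfl⟩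
    refine ⟨⟨(n, 0), C ξ, c⟩, ?_, ?_⟩
    · rw [Finset.mem_coe, mem_Ind]
      exact ⟨rfl, by simp [Gz], hc⟩
    · simp [Elt, RatFunc.algebraMap_C]
  · rintro ⟨⟨⟨r, s⟩, G, c⟩, hy, rfl⟩
    rw [Finset.mem_coe, mem_Ind] at hy
    obtain ⟨h1, h2, h3⟩ := hy
    simp only [Gz] at h1 h2 h3
    split_ifs at h2 with hs
    · subst hs
      rw [Finset.mem_singleton] at h2
      subst h2
      rw [add_zero] at h1
      subst h1
      exact ⟨_, ⟨c, h3, rfl⟩, by simp [Elt, RatFunc.algebraMap_C]⟩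
    · simp at h2

lemma F_eq (n : ℕ) : Ffam Fq n = Elt '' (Ind (Gz (0 : Fq)) n : Set _) := by
  rw [← F'_eq, F'fam]
  simp

open scoped Classical in
/-- the finset of odd polynomial parts -/
def Gs (ξ : Fq) (s : ℕ) : Finset Fq[X] :=
  (({0, ξ} : Finset Fq) ×ˢ (Finset.univ : Finset (Fin s → Fq))).image
      (fun y => C y.1 + ∑ i : Fin s, C (y.2 i) * X ^ (2 * (i : ℕ) + 1))

lemma Gfam_sub (ξ : Fq) (s : ℕ) : Gfam ξ s ⊆ (Gs ξ s : Set Fq[X]) := by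
  classical
  rintro G ⟨α, c, hα, _, rfl⟩
  rw [Gs, Finset.mem_coe, Finset.mem_image]
  refine ⟨(α, fun i => c (i + 1)), ?_, ?_⟩
  · simpa using hα
  · simp only
    congr 1
    rw [Fin.sum_univ_eq_sum_range (fun i => C (c (i + 1)) * (X : Fq[X]) ^ (2 * i + 1)) s,
      sum_Icc_shift]
    exact Finset.sum_congr rfl fun i _ => by rw [show 2 * (i + 1) - 1 = 2 * i + 1 by omega]

open scoped Classical in
/-- the finset of odd polynomial parts of positive degree -/
def Gi (ξ : Fq) (s : ℕ) : Finset Fq[X] :=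
  if s = 0 then ∅ else (Gs ξ s).filter (fun G => G ∈ Gfam ξ s)

lemma mem_Gi {ξ : Fq} {s : ℕ} {G : Fq[X]} : G ∈ Gi ξ s ↔ 1 ≤ s ∧ G ∈ Gfam ξ s := by
  classical
  rw [Gi]
  split_ifs with h
  · simp [h]
  · rw [Finset.mem_filter]
    exact ⟨fun h' => ⟨by omega, h'.2⟩, fun h' => ⟨Gfam_sub ξ s h'.2, h'.2⟩⟩

lemma Gi_bound (ξ : Fq) (s : ℕ) : ((Gi ξ s).card : ℝ) ≤ 2 * qq Fq ^ s := by
  classical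
  have h : (Gi ξ s).card ≤ 2 * Fintype.card Fq ^ s := by
    have h1 : (Gi ξ s).card ≤ (Gs ξ s).card := by
      refine Finset.card_le_card fun G hG => ?_
      exact Gfam_sub ξ s (mem_Gi.mp hG).2
    refine h1.trans (Finset.card_image_le.trans ?_)
    rw [Finset.card_product]
    refine Nat.mul_le_mul Finset.card_le_two ?_
    simp
  exact_mod_cast h

lemma Gi_ne (ξ : Fq) : ∃ s, (Gi ξ s).Nonempty :=
  ⟨1, C 0 + ∑ i ∈ Finset.Icc 1 1, C ((fun _ => 1 : ℕ → Fq) i) * X ^ (2 * i - 1),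
    mem_Gi.mpr ⟨le_rfl, 0, fun _ => 1, Or.inl rfl, one_ne_zero, rfl⟩⟩

lemma I_eq (ξ : Fq) (n : ℕ) : Ifam ξ n = Elt '' (Ind (Gi ξ) n : Set _) := by
  ext u
  simp only [Ifam, Set.mem_iUnion, Irs, Ffam_eq]
  constructor
  · rintro ⟨r, s, hs, hrs, _, ⟨c, hc, rfl⟩, G, hG, rfl⟩
    refine ⟨⟨(r, s), G, c⟩, ?_, rfl⟩
    rw [Finset.mem_coe, mem_Ind]
    exact ⟨hrs, mem_Gi.mpr ⟨hs, hG⟩, hc⟩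
  · rintro ⟨⟨⟨r, s⟩, G, c⟩, hy, rfl⟩
    rw [Finset.mem_coe, mem_Ind] at hy
    obtain ⟨h1, h2, h3⟩ := hy
    rw [mem_Gi] at h2
    exact ⟨r, s, h2.1, h1, _, ⟨c, h3, rfl⟩, G, h2.2, rfl⟩

end final

theorem statement6 {Fq : Type} [Field Fq] [Fintype Fq] (hchar : ringChar Fq = 2)
    (hq : 2 < Fintype.card Fq) (ξ : Fq) (hξ : ∀ x : Fq, x ^ 2 + x ≠ ξ) :
    Filter.Tendsto
      (fun g : ℕ =>
        ((∑' u : (Ifam ξ (g + 1) : Set (RatFunc Fq)), Lfun (2 * g) u.1 1) /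
            (Nat.card (Ifam ξ (g + 1) : Set (RatFunc Fq)) : ℂ)) /
          (zetaC (Fintype.card Fq) 2 * eulerP Fq 2))
      Filter.atTop (nhds 1) ∧
    Filter.Tendsto
      (fun g : ℕ =>
        ((∑' u : (Ffam Fq (g + 1) : Set (RatFunc Fq)), Lfun (2 * g + 1) u.1 1) /
            (Nat.card (Ffam Fq (g + 1) : Set (RatFunc Fq)) : ℂ)) /
          (zetaC (Fintype.card Fq) 2 * eulerP Fq 2))
      Filter.atTop (nhds 1) ∧
    Filter.Tendsto
      (fun g : ℕ =>
        ((∑' u : (F'fam ξ (g + 1) : Set (RatFunc Fq)), Lfun (2 * g + 1) u.1 1) /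
            (Nat.card (F'fam ξ (g + 1) : Set (RatFunc Fq)) : ℂ)) /
          (zetaC (Fintype.card Fq) 2 * eulerP Fq 2))
      Filter.atTop (nhds 1) := by
  haveI : CharP Fq 2 := ringChar.of_eq hchar
  exact ⟨fam_limit hq (Gi_bound ξ) (Gi_ne ξ) (N := fun g => 2 * g) (fun _ => Or.inl rfl) (I_eq ξ),
    fam_limit hq (Gz_bound 0) ⟨0, by simp [Gz]⟩ (N := fun g => 2 * g + 1)
      (fun _ => Or.inr rfl) F_eq,
    fam_limit hq (Gz_bound ξ) ⟨0, by simp [Gz]⟩ (N := fun g => 2 * g + 1)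
      (fun _ => Or.inr rfl) (F'_eq ξ)⟩

end EvenChar
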